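/- arXiv:1906.09014 — 8 statements merged into one kernel-verified Lean document; each statement's English description precedes it below -/
import Mathlib

section
/- Let D be an nc set of d-tuples of complex Hermitian matrices, i.e. a family (D_n)_{n≥1} with D_n ⊆ (H_n)^d (H_n the n×n complex Hermitian matrices) that is closed under direct sums: if X ∈ D_n and Y ∈ D_m then the entrywise block-diagonal tuple X ⊕ Y = diag(X,Y) lies in D_{n+m}. Let w be a graded function on D (w maps D_n into H_n for every n) that respects direct sums (w(X ⊕ Y) = w(X) ⊕ w(Y) for all X, Y ∈ D) and respects unitary equivalence (for every X ∈ D_n and every n×n unitary U with the entrywise conjugated tuple U X U* ∈ D_n one has w(U X U*) = U w(X) U*). Then w respects intertwining: for every X ∈ D_n, Y ∈ D_m and every complex n×m matrix T with X^{(k)} T = T Y^{(k)} for all k = 1,…,d, one has w(X) T = T w(Y). -/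
open Matrix Filter Topology

noncomputable section

/-- The `ℓ²`-operator norm of a rectangular complex matrix. -/
def opNorm {m n : ℕ} (M : Matrix (Fin m) (Fin n) ℂ) : ℝ :=
  ‖(Matrix.toEuclideanLin M).toContinuousLinearMap‖

/-- Direct sum (block diagonal) of two square complex matrices. -/
def dSum {n m : ℕ} (A : Matrix (Fin n) (Fin n) ℂ) (B : Matrix (Fin m) (Fin m) ℂ) :
    Matrix (Fin (n + m)) (Fin (n + m)) ℂ :=
  (Matrix.fromBlocks A 0 0 B).submatrix finSumFinEquiv.symm finSumFinEquiv.symm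

/-- Entrywise direct sum of two tuples of square complex matrices. -/
def dSumT {d n m : ℕ} (X : Fin d → Matrix (Fin n) (Fin n) ℂ)
    (Y : Fin d → Matrix (Fin m) (Fin m) ℂ) :
    Fin d → Matrix (Fin (n + m)) (Fin (n + m)) ℂ := fun k => dSum (X k) (Y k)

open scoped ComplexOrder in
theorem cayley_key {N d : ℕ} (Z : Fin d → Matrix (Fin N) (Fin N) ℂ) (W S : Matrix (Fin N) (Fin N) ℂ)
    (hS : S.IsHermitian) (hSZ : ∀ k, Commute S (Z k))
    (H : ∀ U ∈ Matrix.unitaryGroup (Fin N) ℂ, (∀ k, Commute U (Z k)) → Commute U W) :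
    Commute S W := by
  set J : Matrix (Fin N) (Fin N) ℂ := Complex.I • 1 with hJ
  have hJJ : J * J = -1 := by simp [hJ, smul_smul]
  have hJc : ∀ M, Commute J M := fun M => by
    rw [hJ]; exact (Commute.one_left M).smul_left _
  have hSs : star S = S := hS
  have hJs : star J = -J := by simp [hJ]
  have hP : IsUnit (S * S + 1) := by
    have h1 : (S * Sᴴ).PosSemidef := Matrix.posSemidef_self_mul_conjTranspose S
    rw [hS.eq] at h1
    exact (Matrix.PosDef.posSemidef_add h1 Matrix.PosDef.one).isUnit
  have hSJ : S * J = J * S := ((hJc S).eq).symm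
  have hAB : (S + J) * (S - J) = S * S + 1 := by
    rw [add_mul, mul_sub, mul_sub, hJJ, hSJ]; abel
  have hBA : (S - J) * (S + J) = S * S + 1 := by
    rw [sub_mul, mul_add, mul_add, hJJ, hSJ]; abel
  have hcAB : Commute (S + J) (S - J) := hAB.trans hBA.symm
  obtain ⟨⟨a, ha⟩, ⟨b, hb⟩⟩ := hcAB.isUnit_mul_iff.1 (hAB ▸ hP)
  have hsa : star a = b := by
    ext1; rw [Units.coe_star, ha, hb, star_add, hSs, hJs, sub_eq_add_neg]
  have hsb : star b = a := by rw [← hsa, star_star]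
  have hab : a * b = b * a := by
    ext1; rw [Units.val_mul, Units.val_mul, ha, hb]; exact hcAB
  have hU : b * a⁻¹ * star (b * a⁻¹) = 1 := by
    rw [star_mul, star_inv, hsa, hsb]
    have : a⁻¹ * b⁻¹ = b⁻¹ * a⁻¹ := by rw [← _root_.mul_inv_rev, ← _root_.mul_inv_rev, hab]
    calc b * a⁻¹ * (b⁻¹ * a) = b * (a⁻¹ * b⁻¹) * a := by group
      _ = 1 := by rw [this]; group
  have hUm : ((b * a⁻¹ : (Matrix (Fin N) (Fin N) ℂ)ˣ) : Matrix (Fin N) (Fin N) ℂ) ∈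
      Matrix.unitaryGroup (Fin N) ℂ := by
    rw [Matrix.mem_unitaryGroup_iff, ← Units.coe_star, ← Units.val_mul, hU, Units.val_one]
  have hc := H _ hUm (fun k => by
    rw [Units.val_mul]
    refine Commute.mul_left ?_ (Commute.units_inv_left ?_)
    · rw [hb]; exact (hSZ k).sub_left (hJc _)
    · rw [ha]; exact (hSZ k).add_left (hJc _))
  have hbe : (b : Matrix (Fin N) (Fin N) ℂ) = a - (2 * Complex.I) • 1 := by
    rw [ha, hb, mul_smul, ← hJ, two_smul]; abel
  have hu : ((a⁻¹ : (Matrix (Fin N) (Fin N) ℂ)ˣ) : Matrix (Fin N) (Fin N) ℂ) =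
      (2 * Complex.I)⁻¹ • (1 - ((b * a⁻¹ : (Matrix (Fin N) (Fin N) ℂ)ˣ) : Matrix (Fin N) (Fin N) ℂ)) := by
    rw [Units.val_mul, hbe, sub_mul, Units.mul_inv, sub_sub_cancel, smul_mul_assoc, one_mul,
      smul_smul, inv_mul_cancel₀ (by simp), one_smul]
  have h3 : Commute ((a⁻¹ : (Matrix (Fin N) (Fin N) ℂ)ˣ) : Matrix (Fin N) (Fin N) ℂ) W := by
    rw [hu]; exact ((Commute.one_left W).sub_left hc).smul_left _
  have h4 : Commute (a : Matrix (Fin N) (Fin N) ℂ) W := by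
    simpa using h3.units_inv_left
  have : S = a - J := by rw [ha]; abel
  rw [this]
  exact h4.sub_left (hJc _)

theorem offdiag_commute {n m : ℕ} (A : Matrix (Fin n) (Fin n) ℂ) (B : Matrix (Fin m) (Fin m) ℂ)
    (T : Matrix (Fin n) (Fin m) ℂ) :
    Commute ((Matrix.fromBlocks 0 T Tᴴ 0).submatrix finSumFinEquiv.symm finSumFinEquiv.symm)
      (dSum A B) ↔ (T * B = A * T ∧ Tᴴ * A = B * Tᴴ) := by
  unfold Commute SemiconjBy dSum
  rw [Matrix.submatrix_mul_equiv, Matrix.submatrix_mul_equiv,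
    Matrix.fromBlocks_multiply, Matrix.fromBlocks_multiply]
  constructor
  · intro h
    have h' := congrArg (fun M => Matrix.submatrix M finSumFinEquiv finSumFinEquiv) h
    simp only [Matrix.submatrix_submatrix, Equiv.symm_comp_self, Matrix.submatrix_id_id] at h'
    rw [Matrix.fromBlocks_inj] at h'
    simpa using h'.2
  · rintro ⟨h1, h2⟩
    simp [h1, h2]

/-- A graded function on an nc set of tuples of Hermitian matrices that
respects direct sums and unitary equivalence also respects intertwining. -/
theorem realNC_respects_intertwining (d : ℕ)
    (D : ∀ n : ℕ, Set (Fin d → Matrix (Fin n) (Fin n) ℂ))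
    (hDherm : ∀ n, ∀ X ∈ D n, ∀ k, (X k).IsHermitian)
    (hDsum : ∀ n m, ∀ X ∈ D n, ∀ Y ∈ D m, dSumT X Y ∈ D (n + m))
    (w : ∀ n : ℕ, (Fin d → Matrix (Fin n) (Fin n) ℂ) → Matrix (Fin n) (Fin n) ℂ)
    (hwherm : ∀ n, ∀ X ∈ D n, (w n X).IsHermitian)
    (hwsum : ∀ n m, ∀ X ∈ D n, ∀ Y ∈ D m, w (n + m) (dSumT X Y) = dSum (w n X) (w m Y))
    (hwu : ∀ n, ∀ X ∈ D n, ∀ U : Matrix (Fin n) (Fin n) ℂ, U ∈ Matrix.unitaryGroup (Fin n) ℂ →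
      (fun k => U * X k * star U) ∈ D n →
      w n (fun k => U * X k * star U) = U * w n X * star U) :
    ∀ n m, ∀ X ∈ D n, ∀ Y ∈ D m, ∀ T : Matrix (Fin n) (Fin m) ℂ,
      (∀ k, X k * T = T * Y k) → w n X * T = T * w m Y := by
  intro n m X hX Y hY T hT
  have hZ := hDsum n m X hX Y hY
  have key := cayley_key (dSumT X Y) (w (n + m) (dSumT X Y))
    ((Matrix.fromBlocks 0 T Tᴴ 0).submatrix finSumFinEquiv.symm finSumFinEquiv.symm)
    (by
      apply Matrix.IsHermitian.submatrix
      rw [Matrix.isHermitian_fromBlocks_iff]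
      simp [Matrix.IsHermitian])
    (fun k => (offdiag_commute _ _ _).2 ⟨(hT k).symm, by
      have h := congrArg Matrix.conjTranspose (hT k)
      rwa [Matrix.conjTranspose_mul, Matrix.conjTranspose_mul, (hDherm n X hX k).eq,
        (hDherm m Y hY k).eq] at h⟩)
    (by
      intro U hU hc
      have hUU : U * star U = 1 := (Matrix.mem_unitaryGroup_iff).1 hU
      have hUU' : star U * U = 1 := (Matrix.mem_unitaryGroup_iff').1 hU
      have he : (fun k => U * dSumT X Y k * star U) = dSumT X Y := by
        funext k
        rw [(hc k).eq, mul_assoc, hUU, mul_one]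
      have h := hwu _ _ hZ U hU (he.symm ▸ hZ)
      rw [he] at h
      change U * _ = _ * U
      conv_rhs => rw [h, mul_assoc, hUU', mul_one])
  rw [hwsum n m X hX Y hY, offdiag_commute] at key
  exact key.1.symm
end
end

section
/- Let D be an nc set of d-tuples of complex Hermitian matrices (a family (D_n)_{n≥1}, D_n ⊆ (H_n)^d, closed under direct sums) and let w be a real nc function on D, i.e. w is graded (w maps D_n into H_n), respects direct sums (w(X ⊕ Y) = w(X) ⊕ w(Y)), and respects unitary equivalence (w(U X U*) = U w(X) U* whenever U is unitary and U X U* ∈ D_n). Then w respects similarities: for every X ∈ D_n and every invertible complex n×n matrix S such that the entrywise conjugated tuple S X S^{-1} lies in D_n, one has w(S X S^{-1}) = S w(X) S^{-1}. In particular, every real nc function is an nc function. -/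
open Matrix Filter Topology

noncomputable section

open scoped MatrixOrder ComplexOrder in
theorem ncaux_cayley {n : ℕ} (A W : Matrix (Fin n) (Fin n) ℂ) (hA : A.IsHermitian)
    (h : ∀ V ∈ Matrix.unitaryGroup (Fin n) ℂ, (∀ Z, Commute Z A → Commute Z V) → Commute W V) :
    Commute W A := by
  have hB : IsUnit (A + Complex.I • (1 : Matrix (Fin n) (Fin n) ℂ)) := by
    have h1 : (Aᴴ * A + 1).PosDef :=
      Matrix.PosDef.posSemidef_add (Matrix.posSemidef_conjTranspose_mul_self A) Matrix.PosDef.one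
    have h2 : (A - Complex.I • (1 : Matrix (Fin n) (Fin n) ℂ)) *
        (A + Complex.I • (1 : Matrix (Fin n) (Fin n) ℂ)) = Aᴴ * A + 1 := by
      rw [hA.eq]
      rw [sub_mul, mul_add, mul_add, smul_mul_assoc, smul_mul_assoc, one_mul, one_mul, smul_smul,
        Complex.I_mul_I, mul_smul_comm, mul_one, neg_smul, one_smul]
      abel
    rw [← h2] at h1
    have h3 := h1.isUnit
    rw [Matrix.isUnit_iff_isUnit_det, Matrix.det_mul] at h3
    rw [Matrix.isUnit_iff_isUnit_det]
    exact isUnit_of_mul_isUnit_right h3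
  obtain ⟨u, hu⟩ := hB
  have hsu : star (u : Matrix (Fin n) (Fin n) ℂ) = A - Complex.I • 1 := by
    rw [hu, star_add, Matrix.star_eq_conjTranspose, hA.eq]
    simp [sub_eq_add_neg]
  have hcu : ∀ Z, Commute Z A → Commute Z (u : Matrix (Fin n) (Fin n) ℂ) := by
    intro Z hZ
    rw [hu]
    exact hZ.add_right ((Commute.one_right Z).smul_right _)
  have hcs : ∀ Z, Commute Z A → Commute Z (star (u : Matrix (Fin n) (Fin n) ℂ)) := by
    intro Z hZ
    rw [hsu]
    exact hZ.sub_right ((Commute.one_right Z).smul_right _)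
  have hc : Commute (star u) u := by
    have := hcu _ (hcs A (Commute.refl A)).symm
    exact Units.ext this
  have hV := h ((star u * u⁻¹ : (Matrix (Fin n) (Fin n) ℂ)ˣ)) (by
      rw [Matrix.mem_unitaryGroup_iff]
      rw [← Units.coe_star, ← Units.val_mul, star_mul, star_star, star_inv]
      rw [Units.val_eq_one]
      have h5 : u⁻¹ * (star u)⁻¹ = (star u)⁻¹ * u⁻¹ := by
        rw [← _root_.mul_inv_rev, ← _root_.mul_inv_rev, hc.eq]
      calc star u * u⁻¹ * ((star u)⁻¹ * u) = star u * (u⁻¹ * (star u)⁻¹) * u := by group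
        _ = 1 := by rw [h5]; group) (by
      intro Z hZ
      rw [Units.val_mul]
      exact (hcs Z hZ).mul_right (hcu Z hZ).units_inv_right)
  have h6 : (((2 * Complex.I)⁻¹ : ℂ) • (1 - ((star u * u⁻¹ : (Matrix (Fin n) (Fin n) ℂ)ˣ) :
      Matrix (Fin n) (Fin n) ℂ))) = ((u⁻¹ : (Matrix (Fin n) (Fin n) ℂ)ˣ) : _) := by
    have h7 : (1 : Matrix (Fin n) (Fin n) ℂ) = u * ((u⁻¹ : (Matrix (Fin n) (Fin n) ℂ)ˣ) : _) := by
      simp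
    have h8 : (u : Matrix (Fin n) (Fin n) ℂ) - star (u : Matrix (Fin n) (Fin n) ℂ)
        = (2 * Complex.I) • 1 := by
      rw [hsu, hu, mul_smul, two_smul]
      abel
    rw [Units.val_mul, Units.coe_star]
    nth_rewrite 1 [h7]
    rw [← sub_mul, h8, smul_mul_assoc, smul_smul, inv_mul_cancel₀ (by simp), one_smul, one_mul]
  have h9 : Commute W ((u⁻¹ : (Matrix (Fin n) (Fin n) ℂ)ˣ) : Matrix (Fin n) (Fin n) ℂ) := by
    rw [← h6]
    exact ((Commute.one_right W).sub_right hV).smul_right _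
  have h10 : Commute W (u : Matrix (Fin n) (Fin n) ℂ) := Commute.units_inv_right_iff.1 h9
  have h11 : A = u - Complex.I • 1 := by rw [hu]; abel
  rw [h11]
  exact h10.sub_right ((Commute.one_right W).smul_right _)

open scoped MatrixOrder ComplexOrder Matrix.Norms.L2Operator in
theorem ncaux_sqrt {n : ℕ} (S : Matrix (Fin n) (Fin n) ℂ) (hS : IsUnit S) :
    ∃ P : Matrix (Fin n) (Fin n) ℂ, P.IsHermitian ∧ IsUnit P ∧ P * P = Sᴴ * S ∧
      ∀ Z, Commute Z (Sᴴ * S) → Commute Z P := by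
  have h0 : (0 : Matrix (Fin n) (Fin n) ℂ) ≤ Sᴴ * S :=
    (Matrix.posSemidef_conjTranspose_mul_self S).nonneg
  refine ⟨CFC.sqrt (Sᴴ * S), (CFC.sqrt_nonneg _).posSemidef.isHermitian, ?_,
    CFC.sqrt_mul_sqrt_self _ h0, ?_⟩
  · rw [CFC.isUnit_sqrt_iff _ h0]
    exact (hS.star).mul hS
  · intro Z hZ
    rw [CFC.sqrt_eq_cfc]
    exact (hZ.symm.cfc_nnreal _).symm

/-- Real nc functions respect similarities, hence are nc functions. -/
theorem realNC_is_NC (d : ℕ)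
    (D : ∀ n : ℕ, Set (Fin d → Matrix (Fin n) (Fin n) ℂ))
    (hDherm : ∀ n, ∀ X ∈ D n, ∀ k, (X k).IsHermitian)
    (hDsum : ∀ n m, ∀ X ∈ D n, ∀ Y ∈ D m, dSumT X Y ∈ D (n + m))
    (w : ∀ n : ℕ, (Fin d → Matrix (Fin n) (Fin n) ℂ) → Matrix (Fin n) (Fin n) ℂ)
    (hwherm : ∀ n, ∀ X ∈ D n, (w n X).IsHermitian)
    (hwsum : ∀ n m, ∀ X ∈ D n, ∀ Y ∈ D m, w (n + m) (dSumT X Y) = dSum (w n X) (w m Y))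
    (hwu : ∀ n, ∀ X ∈ D n, ∀ U : Matrix (Fin n) (Fin n) ℂ, U ∈ Matrix.unitaryGroup (Fin n) ℂ →
      (fun k => U * X k * star U) ∈ D n →
      w n (fun k => U * X k * star U) = U * w n X * star U) :
    ∀ n, ∀ X ∈ D n, ∀ S : Matrix (Fin n) (Fin n) ℂ, IsUnit S →
      (fun k => S * X k * S⁻¹) ∈ D n →
      w n (fun k => S * X k * S⁻¹) = S * w n X * S⁻¹ := by
  intro n X hX S hS hY
  obtain ⟨P, hPh, hPu, hPP, hPc⟩ := ncaux_sqrt S hS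
  have hSd := (Matrix.isUnit_iff_isUnit_det S).1 hS
  have hPd := (Matrix.isUnit_iff_isUnit_det P).1 hPu
  -- X commutes with P
  have hXP : ∀ k, Commute (X k) P := by
    intro k
    apply hPc
    have h1 : (S * X k * S⁻¹)ᴴ = S * X k * S⁻¹ := hDherm n _ hY k
    have h2 : (S * X k * S⁻¹) * S = S * X k := by
      rw [Matrix.mul_assoc, Matrix.nonsing_inv_mul _ hSd, Matrix.mul_one]
    have h3 : Sᴴ * (S * X k * S⁻¹) = X k * Sᴴ := by
      have := congrArg Matrix.conjTranspose h2
      rw [Matrix.conjTranspose_mul, h1, Matrix.conjTranspose_mul, (hDherm n X hX k).eq] at this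
      exact this
    change X k * (Sᴴ * S) = Sᴴ * S * X k
    rw [← Matrix.mul_assoc, ← h3, Matrix.mul_assoc, h2, Matrix.mul_assoc]
  -- w X commutes with P
  have hWP : Commute (w n X) P := by
    apply ncaux_cayley P _ hPh
    intro V hV hVc
    have hVV : star V * V = 1 := Matrix.mem_unitaryGroup_iff'.1 hV
    have hVV' : V * star V = 1 := Matrix.mem_unitaryGroup_iff.1 hV
    have e : (fun k => V * X k * star V) = X := by
      funext k
      rw [← (hVc _ (hXP k)).eq, Matrix.mul_assoc, hVV', Matrix.mul_one]
    have h := hwu n X hX V hV (by rw [e]; exact hX)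
    rw [e] at h
    change w n X * V = V * w n X
    calc w n X * V = V * w n X * star V * V := by rw [← h]
      _ = V * w n X := by rw [Matrix.mul_assoc, hVV, Matrix.mul_one]
  have hPi : P * P⁻¹ = 1 := Matrix.mul_nonsing_inv _ hPd
  have hiP : P⁻¹ * P = 1 := Matrix.nonsing_inv_mul _ hPd
  have hSi : S * S⁻¹ = 1 := Matrix.mul_nonsing_inv _ hSd
  have hstar : star (S * P⁻¹) = P * S⁻¹ := by
    rw [star_mul, Matrix.star_eq_conjTranspose, Matrix.star_eq_conjTranspose,
      Matrix.conjTranspose_nonsing_inv, hPh.eq]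
    calc P⁻¹ * Sᴴ = P⁻¹ * (Sᴴ * S) * S⁻¹ := by
          rw [Matrix.mul_assoc, Matrix.mul_assoc, hSi, Matrix.mul_one]
      _ = P * S⁻¹ := by rw [← hPP, ← Matrix.mul_assoc, hiP, Matrix.one_mul]
  have hU : S * P⁻¹ ∈ Matrix.unitaryGroup (Fin n) ℂ := by
    rw [Matrix.mem_unitaryGroup_iff, hstar]
    calc S * P⁻¹ * (P * S⁻¹) = S * (P⁻¹ * P) * S⁻¹ := by simp only [Matrix.mul_assoc]
      _ = 1 := by rw [hiP, Matrix.mul_one, hSi]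
  have key : ∀ Z, Commute Z P → S * P⁻¹ * Z * star (S * P⁻¹) = S * Z * S⁻¹ := by
    intro Z hZ
    rw [hstar]
    calc S * P⁻¹ * Z * (P * S⁻¹) = S * P⁻¹ * (Z * P) * S⁻¹ := by simp only [Matrix.mul_assoc]
      _ = S * (P⁻¹ * P) * Z * S⁻¹ := by rw [hZ.eq]; simp only [Matrix.mul_assoc]
      _ = S * Z * S⁻¹ := by rw [hiP, Matrix.mul_one]
  have e : (fun k => S * P⁻¹ * X k * star (S * P⁻¹)) = fun k => S * X k * S⁻¹ :=
    funext fun k => key _ (hXP k)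
  have h := hwu n X hX _ hU (by rw [e]; exact hY)
  rw [e, key _ hWP] at h
  exact h
end
end

section
/- Let X = (X^{(1)},…,X^{(d)}) be a d-tuple of n×n complex Hermitian matrices, Y = (Y^{(1)},…,Y^{(d)}) a d-tuple of m×m complex Hermitian matrices, and T a complex n×m matrix with ‖T‖ ≤ 1 (operator norm) such that X^{(k)} T = T Y^{(k)} for all k. Set D_T := (I_m − T*T)^{1/2}, D_{T*} := (I_n − T T*)^{1/2}, and let U_T be the (n+m)×(n+m) block matrix U_T = [[T, D_{T*}],[D_T, −T*]]. Then U_T is unitary and U_T* · diag(X^{(k)}, Y^{(k)}) · U_T = diag(Y^{(k)}, X^{(k)}) for every k = 1,…,d. -/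
open Matrix Filter Topology ComplexOrder

noncomputable section

/-- The unitary rotation matrix associated with a contraction `T` with defect matrices
`DTs = (1 - T Tᴴ)^{1/2}` and `DT = (1 - Tᴴ T)^{1/2}`. -/
def UT {n m : ℕ} (T : Matrix (Fin n) (Fin m) ℂ) (DTs : Matrix (Fin n) (Fin n) ℂ)
    (DT : Matrix (Fin m) (Fin m) ℂ) : Matrix (Fin n ⊕ Fin m) (Fin m ⊕ Fin n) ℂ :=
  Matrix.fromBlocks T DTs DT (-Tᴴ)

open scoped MatrixOrder in
lemma psd_factor {m : ℕ} (B : Matrix (Fin m) (Fin m) ℂ) (hB : B.PosSemidef) :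
    ∃ C : Matrix (Fin m) (Fin m) ℂ, B = Cᴴ * C :=
  CStarAlgebra.nonneg_iff_eq_star_mul_self.mp hB.nonneg

lemma sq_intertwine {n m : ℕ} (A : Matrix (Fin n) (Fin n) ℂ) (B : Matrix (Fin m) (Fin m) ℂ)
    (M : Matrix (Fin n) (Fin m) ℂ) (hA : A.PosSemidef) (hB : B.PosSemidef)
    (h : A * A * M = M * (B * B)) : A * M = M * B := by
  obtain ⟨Z, hZ⟩ : ∃ Z, Z = A * M - M * B := ⟨_, rfl⟩
  have h0 : A * Z + Z * B = 0 := by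
    rw [hZ, Matrix.mul_sub, Matrix.sub_mul, ← Matrix.mul_assoc, h]
    simp only [Matrix.mul_assoc]
    abel
  have p1 := hA.conjTranspose_mul_mul_same Z
  have p2 := hB.mul_mul_conjTranspose_same Z
  have t : (Zᴴ * A * Z).trace + (Z * B * Zᴴ).trace = 0 := by
    rw [Matrix.trace_mul_comm (Z * B), ← Matrix.trace_add, Matrix.mul_assoc, ← Matrix.mul_add, h0]
    simp
  have t2 : (Z * B * Zᴴ).trace = 0 :=
    ((add_eq_zero_iff_of_nonneg p1.trace_nonneg p2.trace_nonneg).1 t).2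
  have z2 : Z * B * Zᴴ = 0 := p2.trace_eq_zero_iff.1 t2
  have zb : Z * B = 0 := by
    obtain ⟨C, hC⟩ := psd_factor B hB
    have : (Z * Cᴴ) * (Z * Cᴴ)ᴴ = 0 := by
      rw [← z2, hC]; simp [Matrix.mul_assoc]
    have h3 := Matrix.self_mul_conjTranspose_eq_zero.1 this
    rw [hC, ← Matrix.mul_assoc, h3, Matrix.zero_mul]
  have az : A * Z = 0 := by simpa [zb] using h0
  have za : Zᴴ * A = 0 := by
    have := congrArg Matrix.conjTranspose az
    simpa [hA.1.eq] using this
  have bz : B * Zᴴ = 0 := by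
    have := congrArg Matrix.conjTranspose zb
    simpa [hB.1.eq] using this
  have tz : (Zᴴ * Z).trace = 0 := by
    have : Zᴴ * Z = - (Zᴴ * M * B) := by
      conv_lhs => rw [hZ, Matrix.mul_sub, ← hZ, ← Matrix.mul_assoc, za]
      simp [Matrix.mul_assoc]
    rw [this, Matrix.trace_neg, Matrix.trace_mul_comm, ← Matrix.mul_assoc, bz]
    simp
  have z0 : Z = 0 := Matrix.trace_conjTranspose_mul_self_eq_zero_iff.1 tz
  exact sub_eq_zero.1 (hZ ▸ z0)

/-- The unitary rotation associated with an intertwining contraction conjugates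
`diag(X, Y)` to `diag(Y, X)`. -/
theorem unitary_rotation_conjugates (d n m : ℕ)
    (X : Fin d → Matrix (Fin n) (Fin n) ℂ) (Y : Fin d → Matrix (Fin m) (Fin m) ℂ)
    (hX : ∀ k, (X k).IsHermitian) (hY : ∀ k, (Y k).IsHermitian)
    (T : Matrix (Fin n) (Fin m) ℂ) (hT : opNorm T ≤ 1)
    (hTX : ∀ k, X k * T = T * Y k)
    (DT : Matrix (Fin m) (Fin m) ℂ) (DTs : Matrix (Fin n) (Fin n) ℂ)
    (hDT : DT.PosSemidef) (hDT2 : DT * DT = 1 - Tᴴ * T)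
    (hDTs : DTs.PosSemidef) (hDTs2 : DTs * DTs = 1 - T * Tᴴ) :
    (UT T DTs DT)ᴴ * UT T DTs DT = 1 ∧
    UT T DTs DT * (UT T DTs DT)ᴴ = 1 ∧
    ∀ k, (UT T DTs DT)ᴴ * Matrix.fromBlocks (X k) 0 0 (Y k) * UT T DTs DT =
      Matrix.fromBlocks (Y k) 0 0 (X k) := by
  have c1 : DTs * T = T * DT := sq_intertwine _ _ _ hDTs hDT (by
    rw [hDT2, hDTs2]; simp [Matrix.sub_mul, Matrix.mul_sub, Matrix.mul_assoc])
  have c1' : Tᴴ * DTs = DT * Tᴴ := by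
    have := congrArg Matrix.conjTranspose c1
    simpa [hDT.1.eq, hDTs.1.eq] using this
  have hTY : ∀ k, Tᴴ * X k = Y k * Tᴴ := fun k => by
    have := congrArg Matrix.conjTranspose (hTX k)
    simpa [(hX k).eq, (hY k).eq] using this
  have hU : (UT T DTs DT)ᴴ = Matrix.fromBlocks Tᴴ DT DTs (-T) := by
    simp [UT, Matrix.fromBlocks_conjTranspose, hDT.1.eq, hDTs.1.eq]
  have u1 : (UT T DTs DT)ᴴ * UT T DTs DT = 1 := by
    rw [hU, UT, Matrix.fromBlocks_multiply, ← Matrix.fromBlocks_one]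
    congr 1
    · rw [hDT2]; abel
    · rw [c1']; simp
    · rw [c1]; simp
    · rw [hDTs2]; simp
  have u2 : UT T DTs DT * (UT T DTs DT)ᴴ = 1 := by
    rw [hU, UT, Matrix.fromBlocks_multiply, ← Matrix.fromBlocks_one]
    congr 1
    · rw [hDTs2]; abel
    · rw [← c1]; simp
    · rw [← c1']; simp
    · rw [hDT2]; simp
  refine ⟨u1, u2, fun k => ?_⟩
  have e1 : DTs * X k = X k * DTs := sq_intertwine _ _ _ hDTs hDTs (by
    rw [hDTs2, Matrix.sub_mul, Matrix.mul_sub, Matrix.mul_assoc, hTY, ← Matrix.mul_assoc, ← hTX,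
      Matrix.mul_assoc]; simp)
  have e2 : DT * Y k = Y k * DT := sq_intertwine _ _ _ hDT hDT (by
    rw [hDT2, Matrix.sub_mul, Matrix.mul_sub, Matrix.mul_assoc, ← hTX, ← Matrix.mul_assoc, hTY,
      Matrix.mul_assoc]; simp)
  have e : Matrix.fromBlocks (X k) 0 0 (Y k) * UT T DTs DT
      = UT T DTs DT * Matrix.fromBlocks (Y k) 0 0 (X k) := by
    simp [UT, Matrix.fromBlocks_multiply, e1, e2, hTX, hTY]
  rw [Matrix.mul_assoc, e, ← Matrix.mul_assoc, u1, Matrix.one_mul]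
end
end

section
/- Let D be an nc set of complex Hermitian matrices (a family (D_n)_{n≥1} of subsets D_n of the n×n complex Hermitian matrices, closed under direct sums), and let D^{(ue)} denote its unitary equivalence envelope, D^{(ue)} := { U X U* : X ∈ D_n, U an n×n unitary, n ≥ 1 }. Then D^{(ue)} is a real free set — i.e. an nc set of Hermitian matrices closed under unitary equivalence with the property that X ⊕ Y ∈ D^{(ue)} if and only if both X ∈ D^{(ue)} and Y ∈ D^{(ue)} — if and only if D^{(ue)} is closed under injective intertwining: whenever X ∈ D^{(ue)}_n, Y is an m×m Hermitian matrix, and S is an injective complex n×m matrix with X S = S Y, then Y ∈ D^{(ue)}. -/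
open Matrix Filter Topology

noncomputable section

open scoped MatrixOrder ComplexOrder in
theorem aux_polar {n m : ℕ} (X : Matrix (Fin n) (Fin n) ℂ) (hX : X.IsHermitian)
    (Y : Matrix (Fin m) (Fin m) ℂ) (hY : Y.IsHermitian)
    (S : Matrix (Fin n) (Fin m) ℂ) (hS : Function.Injective S.mulVec) (h : X * S = S * Y) :
    ∃ V : Matrix (Fin n) (Fin m) ℂ, Vᴴ * V = 1 ∧ X * V = V * Y := by
  have hP : (Sᴴ * S).PosDef := PosDef.conjTranspose_mul_self S hS
  have h' : Sᴴ * X = Y * Sᴴ := by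
    have := congrArg conjTranspose h
    simpa [conjTranspose_mul, hX.eq, hY.eq] using this
  have hc : Commute (Sᴴ * S) Y := by
    show Sᴴ * S * Y = Y * (Sᴴ * S)
    rw [Matrix.mul_assoc, ← h, ← Matrix.mul_assoc, h', Matrix.mul_assoc]
  have hnn : 0 ≤ Sᴴ * S := hP.posSemidef.nonneg
  set R := CFC.sqrt (Sᴴ * S) with hR
  have hRR : R * R = Sᴴ * S := CFC.sqrt_mul_sqrt_self _ hnn
  have hRY : R * Y = Y * R := hc.cfcₙ_nnreal _
  have hRh : Rᴴ = R := (nonneg_iff_posSemidef.mp (CFC.sqrt_nonneg (Sᴴ * S))).isHermitian.eq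
  have hdet : IsUnit R.det := by
    have h1 : IsUnit (Sᴴ * S).det := (Matrix.isUnit_iff_isUnit_det _).mp hP.isUnit
    rw [← hRR, det_mul] at h1
    exact isUnit_of_mul_isUnit_left h1
  have hYR : Y * R⁻¹ = R⁻¹ * Y := by
    calc Y * R⁻¹ = R⁻¹ * R * (Y * R⁻¹) := by rw [nonsing_inv_mul _ hdet, Matrix.one_mul]
      _ = R⁻¹ * (R * Y) * R⁻¹ := by simp only [Matrix.mul_assoc]
      _ = R⁻¹ * Y * (R * R⁻¹) := by rw [hRY]; simp only [Matrix.mul_assoc]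
      _ = R⁻¹ * Y := by rw [mul_nonsing_inv _ hdet, Matrix.mul_one]
  refine ⟨S * R⁻¹, ?_, ?_⟩
  · rw [conjTranspose_mul, conjTranspose_nonsing_inv, hRh]
    calc R⁻¹ * Sᴴ * (S * R⁻¹) = R⁻¹ * (Sᴴ * S) * R⁻¹ := by simp only [Matrix.mul_assoc]
      _ = (R⁻¹ * R) * (R * R⁻¹) := by rw [← hRR]; simp only [Matrix.mul_assoc]
      _ = 1 := by rw [mul_nonsing_inv _ hdet, nonsing_inv_mul _ hdet, Matrix.mul_one]
  · rw [← Matrix.mul_assoc, h, Matrix.mul_assoc, hYR, Matrix.mul_assoc]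

theorem aux_extend {m k : ℕ} (V : Matrix (Fin (m + k)) (Fin m) ℂ) (hV : Vᴴ * V = 1) :
    ∃ U ∈ Matrix.unitaryGroup (Fin (m + k)) ℂ, ∀ i j, U i (Fin.castAdd k j) = V i j := by
  let v : Fin (m + k) → EuclideanSpace ℂ (Fin (m + k)) :=
    Fin.append (fun j => WithLp.toLp 2 (fun i => V i j)) (fun _ => 0)
  have hv : Orthonormal ℂ ((Set.range (Fin.castAdd k : Fin m → _)).domRestrict v) := by
    rw [orthonormal_iff_ite]
    rintro ⟨_, a, rfl⟩ ⟨_, b, rfl⟩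
    have h1 := congrFun (congrFun hV a) b
    rw [Matrix.mul_apply, Matrix.one_apply] at h1
    have h2 : (inner ℂ (v (Fin.castAdd k a)) (v (Fin.castAdd k b)) : ℂ)
        = if a = b then 1 else 0 := by
      rw [← h1]
      simp [v, PiLp.inner_apply, mul_comm]
    refine h2.trans ?_
    by_cases hab : a = b
    · subst hab; simp
    · rw [if_neg hab, if_neg]
      intro hh
      exact hab (Fin.castAdd_injective m k (congrArg Subtype.val hh))
  obtain ⟨b, hb⟩ := hv.exists_orthonormalBasis_extension_of_card_eq (by simp)
  refine ⟨Matrix.of fun i j => b j i, ?_, ?_⟩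
  · rw [Matrix.mem_unitaryGroup_iff']
    ext i j
    have h1 := (orthonormal_iff_ite.mp b.orthonormal) i j
    rw [Matrix.mul_apply, Matrix.one_apply, ← h1]
    simp [PiLp.inner_apply, mul_comm]
  · intro i j
    simp [hb _ ⟨j, rfl⟩, v]

theorem aux_split {m k : ℕ} (X : Matrix (Fin (m + k)) (Fin (m + k)) ℂ) (hX : X.IsHermitian)
    (Y : Matrix (Fin m) (Fin m) ℂ)
    (V : Matrix (Fin (m + k)) (Fin m) ℂ) (h : X * V = V * Y)
    (U : Matrix (Fin (m + k)) (Fin (m + k)) ℂ) (hU : U ∈ Matrix.unitaryGroup (Fin (m + k)) ℂ)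
    (hUV : ∀ i j, U i (Fin.castAdd k j) = V i j) :
    ∃ Z : Matrix (Fin k) (Fin k) ℂ, Z.IsHermitian ∧ star U * X * U = dSum Y Z := by
  have hM : (star U * X * U).IsHermitian := by
    rw [star_eq_conjTranspose]
    exact isHermitian_conjTranspose_mul_mul U hX
  have hUU : star U * U = 1 := Matrix.mem_unitaryGroup_iff'.mp hU
  have hVs : V = U.submatrix id (Fin.castAdd k) := by
    ext i j; simp [hUV]
  have hcol : (star U * X * U).submatrix id (Fin.castAdd k)
      = (1 : Matrix (Fin (m + k)) (Fin (m + k)) ℂ).submatrix id (Fin.castAdd k) * Y := by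
    have e1 : (star U * X * U).submatrix id (Fin.castAdd k) = star U * X * V := by
      rw [hVs]; rfl
    have e2 : (star U * U).submatrix id (Fin.castAdd k) = star U * V := by
      rw [hVs]; rfl
    rw [e1, Matrix.mul_assoc, h, ← Matrix.mul_assoc, ← e2, hUU]
  set M := star U * X * U with hMdef
  have h11 : ∀ i j, M (Fin.castAdd k i) (Fin.castAdd k j) = Y i j := by
    intro i j
    have := congrFun (congrFun hcol (Fin.castAdd k i)) j
    simpa [Matrix.mul_apply, Matrix.one_apply] using this
  have h21 : ∀ i j, M (Fin.natAdd m i) (Fin.castAdd k j) = 0 := by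
    intro i j
    have := congrFun (congrFun hcol (Fin.natAdd m i)) j
    have hne : ∀ x : Fin m, Fin.natAdd m i ≠ Fin.castAdd k x := by
      intro x hx
      have := congrArg Fin.val hx
      simp at this
      omega
    simpa [Matrix.mul_apply, Matrix.one_apply, hne] using this
  have h12 : ∀ i j, M (Fin.castAdd k j) (Fin.natAdd m i) = 0 := by
    intro i j
    rw [← hM.apply, h21, star_zero]
  refine ⟨M.submatrix (Fin.natAdd m) (Fin.natAdd m), hM.submatrix _, ?_⟩
  ext i j
  refine Fin.addCases (fun i => ?_) (fun i => ?_) i <;>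
    refine Fin.addCases (fun j => ?_) (fun j => ?_) j <;>
    simp [dSum, h11, h21, h12]

theorem aux_dSum_mul {n m : ℕ} (A A' : Matrix (Fin n) (Fin n) ℂ) (B B' : Matrix (Fin m) (Fin m) ℂ) :
    dSum A B * dSum A' B' = dSum (A * A') (B * B') := by
  simp [dSum, Matrix.submatrix_mul_equiv, Matrix.fromBlocks_multiply]

theorem aux_dSum_star {n m : ℕ} (A : Matrix (Fin n) (Fin n) ℂ) (B : Matrix (Fin m) (Fin m) ℂ) :
    star (dSum A B) = dSum (star A) (star B) := by
  simp [dSum, star_eq_conjTranspose, Matrix.fromBlocks_conjTranspose]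

theorem aux_dSum_one {n m : ℕ} :
    dSum (1 : Matrix (Fin n) (Fin n) ℂ) (1 : Matrix (Fin m) (Fin m) ℂ) = 1 := by
  simp [dSum]

theorem aux_inj {n m : ℕ} (f : Fin m → Fin n) (hf : Function.Injective f) :
    Function.Injective ((1 : Matrix (Fin n) (Fin n) ℂ).submatrix id f).mulVec := by
  have h : (1 : Matrix (Fin n) (Fin n) ℂ).submatrix f id
      * (1 : Matrix (Fin n) (Fin n) ℂ).submatrix id f = 1 := by
    have : (1 : Matrix (Fin n) (Fin n) ℂ).submatrix f id
      * (1 : Matrix (Fin n) (Fin n) ℂ).submatrix id f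
      = ((1 : Matrix (Fin n) (Fin n) ℂ) * 1).submatrix f f := rfl
    rw [this, Matrix.mul_one, Matrix.submatrix_one _ hf]
  intro x y hxy
  have := congrArg (((1 : Matrix (Fin n) (Fin n) ℂ).submatrix f id).mulVec) hxy
  simpa only [Matrix.mulVec_mulVec, h, Matrix.one_mulVec] using this

theorem aux_incl_left {n m : ℕ} (A : Matrix (Fin n) (Fin n) ℂ) (B : Matrix (Fin m) (Fin m) ℂ) :
    dSum A B * (1 : Matrix (Fin (n + m)) (Fin (n + m)) ℂ).submatrix id (Fin.castAdd m)
      = (1 : Matrix (Fin (n + m)) (Fin (n + m)) ℂ).submatrix id (Fin.castAdd m) * A := by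
  ext i j
  refine Fin.addCases (fun i => ?_) (fun i => ?_) i <;>
    simp [dSum, Matrix.mul_apply, Matrix.one_apply, Fin.sum_univ_add, Fin.ext_iff]
  · simp [← Fin.ext_iff]
  · rw [Finset.sum_eq_zero (fun x _ => if_neg (by omega)),
      Finset.sum_eq_zero (fun x _ => if_neg (by omega))]

theorem aux_incl_right {n m : ℕ} (A : Matrix (Fin n) (Fin n) ℂ) (B : Matrix (Fin m) (Fin m) ℂ) :
    dSum A B * (1 : Matrix (Fin (n + m)) (Fin (n + m)) ℂ).submatrix id (Fin.natAdd n)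
      = (1 : Matrix (Fin (n + m)) (Fin (n + m)) ℂ).submatrix id (Fin.natAdd n) * B := by
  ext i j
  refine Fin.addCases (fun i => ?_) (fun i => ?_) i <;>
    simp [dSum, Matrix.mul_apply, Matrix.one_apply, Fin.sum_univ_add, Fin.ext_iff]
  · rw [Finset.sum_eq_zero (fun x _ => if_neg (by omega)),
      Finset.sum_eq_zero (fun x _ => if_neg (by omega))]
  · simp [← Fin.ext_iff]

/-- The unitary equivalence envelope of an nc set of Hermitian matrices is a
real free set if and only if it is closed under injective intertwining. -/
theorem realFree_iff_closed_injective_intertwining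
    (D : ∀ n : ℕ, Set (Matrix (Fin n) (Fin n) ℂ))
    (hherm : ∀ n, ∀ X ∈ D n, X.IsHermitian)
    (hsum : ∀ n m, ∀ X ∈ D n, ∀ Y ∈ D m, dSum X Y ∈ D (n + m))
    (E : ∀ n : ℕ, Set (Matrix (Fin n) (Fin n) ℂ))
    (hE : ∀ n (Y : Matrix (Fin n) (Fin n) ℂ), Y ∈ E n ↔
      ∃ X ∈ D n, ∃ U ∈ Matrix.unitaryGroup (Fin n) ℂ, Y = U * X * star U) :
    ((∀ n m, ∀ X ∈ E n, ∀ Y ∈ E m, dSum X Y ∈ E (n + m)) ∧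
     (∀ n, ∀ X ∈ E n, ∀ U ∈ Matrix.unitaryGroup (Fin n) ℂ, U * X * star U ∈ E n) ∧
     (∀ n m (X : Matrix (Fin n) (Fin n) ℂ) (Y : Matrix (Fin m) (Fin m) ℂ),
        X.IsHermitian → Y.IsHermitian → (dSum X Y ∈ E (n + m) ↔ X ∈ E n ∧ Y ∈ E m)))
    ↔
    (∀ n m, ∀ X ∈ E n, ∀ Y : Matrix (Fin m) (Fin m) ℂ, Y.IsHermitian →
      ∀ S : Matrix (Fin n) (Fin m) ℂ, Function.Injective S.mulVec →
        X * S = S * Y → Y ∈ E m) := by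
  have hDE : ∀ n X, X ∈ D n → X ∈ E n := fun n X hX =>
    (hE n X).mpr ⟨X, hX, 1, one_mem _, by simp⟩
  have hEh : ∀ n X, X ∈ E n → X.IsHermitian := by
    intro n X hX
    obtain ⟨X0, h0, U, -, rfl⟩ := (hE n X).mp hX
    rw [star_eq_conjTranspose]
    exact isHermitian_mul_mul_conjTranspose U (hherm n X0 h0)
  have hEu : ∀ n, ∀ X ∈ E n, ∀ U ∈ Matrix.unitaryGroup (Fin n) ℂ, U * X * star U ∈ E n := by
    intro n X hX U hU
    obtain ⟨X0, h0, W, hW, rfl⟩ := (hE n X).mp hX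
    refine (hE n _).mpr ⟨X0, h0, U * W, mul_mem hU hW, ?_⟩
    rw [star_mul]
    simp only [Matrix.mul_assoc]
  have hEs : ∀ n m, ∀ X ∈ E n, ∀ Y ∈ E m, dSum X Y ∈ E (n + m) := by
    intro n m X hX Y hY
    obtain ⟨X0, hX0, U, hU, rfl⟩ := (hE n X).mp hX
    obtain ⟨Y0, hY0, W, hW, rfl⟩ := (hE m Y).mp hY
    refine (hE _ _).mpr ⟨dSum X0 Y0, hsum _ _ _ hX0 _ hY0, dSum U W, ?_, ?_⟩
    · rw [Matrix.mem_unitaryGroup_iff] at *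
      rw [aux_dSum_star, aux_dSum_mul, hU, hW, aux_dSum_one]
    · rw [aux_dSum_star, aux_dSum_mul, aux_dSum_mul]
  constructor
  · rintro ⟨-, -, h3⟩ n m X hX Y hY S hS hXS
    have hle : m ≤ n := by
      have := LinearMap.finrank_le_finrank_of_injective (f := S.mulVecLin) hS
      simpa using this
    obtain ⟨k, rfl⟩ := Nat.exists_eq_add_of_le hle
    have hXh := hEh _ X hX
    obtain ⟨V, hV, hXV⟩ := aux_polar X hXh Y hY S hS hXS
    obtain ⟨U, hU, hUV⟩ := aux_extend V hV
    obtain ⟨Z, hZ, hZe⟩ := aux_split X hXh Y V hXV U hU hUV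
    have h1 := hEu _ X hX (star U) (Unitary.star_mem hU)
    rw [star_star, hZe] at h1
    exact ((h3 m k Y Z hY hZ).mp h1).1
  · intro h
    refine ⟨hEs, hEu, fun n m X Y hX hY => ⟨fun hXY => ⟨?_, ?_⟩, fun hXY => hEs _ _ _ hXY.1 _ hXY.2⟩⟩
    · exact h _ _ _ hXY X hX _ (aux_inj _ (Fin.castAdd_injective n m)) (aux_incl_left X Y)
    · exact h _ _ _ hXY Y hY _ (aux_inj _ (Fin.natAdd_injective m n)) (aux_incl_right X Y)
end
end

section
/- Let f be a Gâteaux differentiable nc function on an open nc set D_f of d-tuples of n×n complex matrices, and define u(A,B) := Re f(A+iB) and v(A,B) := Im f(A+iB) on D := {(A,B) : A, B tuples of Hermitian matrices, A+iB ∈ D_f}. Then the Gâteaux derivatives of u and v satisfy the noncommutative Cauchy–Riemann equations: for every n, every (A,B) ∈ D_n, and all d-tuples Z_1, Z_2 of n×n Hermitian matrices, Du(A,B)(Z_1,Z_2) = Dv(A,B)(−Z_2,Z_1). -/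
open Matrix Filter Topology

noncomputable section

/-- The Hermitian real part `(1/2)(M + Mᴴ)` of a square complex matrix. -/
def reM {n : ℕ} (M : Matrix (Fin n) (Fin n) ℂ) : Matrix (Fin n) (Fin n) ℂ :=
  (2⁻¹ : ℂ) • (M + Mᴴ)

/-- The Hermitian imaginary part `(1/(2i))(M − Mᴴ)` of a square complex matrix. -/
def imM {n : ℕ} (M : Matrix (Fin n) (Fin n) ℂ) : Matrix (Fin n) (Fin n) ℂ :=
  (2 * Complex.I)⁻¹ • (M - Mᴴ)

/-- The tuple `A + i B`. -/
def cmb {d n : ℕ} (A B : Fin d → Matrix (Fin n) (Fin n) ℂ) :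
    Fin d → Matrix (Fin n) (Fin n) ℂ := fun k => A k + Complex.I • B k

theorem reM_cont {n : ℕ} : Continuous (reM (n := n)) := by
  unfold reM
  fun_prop

theorem reM_quot {n : ℕ} (t : ℝ) (a b : Matrix (Fin n) (Fin n) ℂ) :
    (t : ℂ)⁻¹ • (reM a - reM b) = reM ((t : ℂ)⁻¹ • (a - b)) := by
  ext i j
  simp [reM, Matrix.conjTranspose_apply]
  ring

theorem imM_quot {n : ℕ} (t : ℝ) (a b : Matrix (Fin n) (Fin n) ℂ) :
    (t : ℂ)⁻¹ • (imM a - imM b) = reM ((Complex.I * (t : ℂ))⁻¹ • (a - b)) := by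
  ext i j
  simp [reM, imM, Matrix.conjTranspose_apply]
  ring

/-- The noncommutative Cauchy–Riemann equations: the Gâteaux derivatives of
`u = Re f` and `v = Im f` exist and satisfy `Du(A,B)(Z₁,Z₂) = Dv(A,B)(−Z₂,Z₁)`. -/
theorem nc_cauchy_riemann (d : ℕ)
    (DF : ∀ n : ℕ, Set (Fin d → Matrix (Fin n) (Fin n) ℂ))
    (hDFsum : ∀ n m, ∀ X ∈ DF n, ∀ Y ∈ DF m, dSumT X Y ∈ DF (n + m))
    (hDFopen : ∀ n, IsOpen (DF n))
    (f : ∀ n : ℕ, (Fin d → Matrix (Fin n) (Fin n) ℂ) → Matrix (Fin n) (Fin n) ℂ)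
    (hfsum : ∀ n m, ∀ X ∈ DF n, ∀ Y ∈ DF m, f (n + m) (dSumT X Y) = dSum (f n X) (f m Y))
    (hfsim : ∀ n, ∀ X ∈ DF n, ∀ S : Matrix (Fin n) (Fin n) ℂ, IsUnit S →
      (fun k => S * X k * S⁻¹) ∈ DF n →
      f n (fun k => S * X k * S⁻¹) = S * f n X * S⁻¹)
    (Df : ∀ n : ℕ, (Fin d → Matrix (Fin n) (Fin n) ℂ) →
      (Fin d → Matrix (Fin n) (Fin n) ℂ) → Matrix (Fin n) (Fin n) ℂ)
    (hDf : ∀ n, ∀ X ∈ DF n, ∀ Z : Fin d → Matrix (Fin n) (Fin n) ℂ,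
      Tendsto (fun t : ℂ => t⁻¹ • (f n (X + t • Z) - f n X)) (𝓝[≠] (0 : ℂ))
        (𝓝 (Df n X Z))) :
    ∀ n (A B Z1 Z2 : Fin d → Matrix (Fin n) (Fin n) ℂ),
      (∀ k, (A k).IsHermitian) → (∀ k, (B k).IsHermitian) →
      (∀ k, (Z1 k).IsHermitian) → (∀ k, (Z2 k).IsHermitian) →
      cmb A B ∈ DF n →
      ∃ L : Matrix (Fin n) (Fin n) ℂ,
        -- `Du(A,B)(Z₁,Z₂)` exists and equals `L`:
        Tendsto (fun t : ℝ =>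
            (t : ℂ)⁻¹ • (reM (f n (cmb (A + t • Z1) (B + t • Z2))) - reM (f n (cmb A B))))
          (𝓝[≠] (0 : ℝ)) (𝓝 L) ∧
        -- `Dv(A,B)(−Z₂,Z₁)` exists and equals the same `L`:
        Tendsto (fun t : ℝ =>
            (t : ℂ)⁻¹ • (imM (f n (cmb (A + t • (-Z2)) (B + t • Z1))) - imM (f n (cmb A B))))
          (𝓝[≠] (0 : ℝ)) (𝓝 L) := by
  intro n A B Z1 Z2 _ _ _ _ hX
  have h := (reM_cont.tendsto _).comp (hDf n _ hX (cmb Z1 Z2))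
  refine ⟨reM (Df n (cmb A B) (cmb Z1 Z2)), ?_, ?_⟩
  · have hm : Tendsto (fun t : ℝ => (t : ℂ)) (𝓝[≠] 0) (𝓝[≠] 0) := by
      refine tendsto_nhdsWithin_iff.2 ⟨?_, ?_⟩
      · exact (Complex.continuous_ofReal.tendsto' 0 0 (by simp)).mono_left nhdsWithin_le_nhds
      · filter_upwards [self_mem_nhdsWithin] with t ht
        simpa using ht
    refine (h.comp hm).congr fun t => ?_
    have e : cmb (A + t • Z1) (B + t • Z2) = cmb A B + (t : ℂ) • cmb Z1 Z2 := by
      ext k i j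
      simp [cmb]
      ring
    rw [reM_quot, e]
    rfl
  · have hm : Tendsto (fun t : ℝ => Complex.I * (t : ℂ)) (𝓝[≠] 0) (𝓝[≠] 0) := by
      refine tendsto_nhdsWithin_iff.2 ⟨?_, ?_⟩
      · exact ((continuous_const.mul Complex.continuous_ofReal).tendsto' 0 0
          (by simp)).mono_left nhdsWithin_le_nhds
      · filter_upwards [self_mem_nhdsWithin] with t ht
        simpa using ht
    refine (h.comp hm).congr fun t => ?_
    have e : cmb (A + t • (-Z2)) (B + t • Z1)
        = cmb A B + (Complex.I * (t : ℂ)) • cmb Z1 Z2 := by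
      ext k i j
      simp [cmb]
      linear_combination (-(t : ℂ) * Z2 k i j) * Complex.I_mul_I
    rw [imM_quot, e]
    rfl
end
end

section
/- Let f be an nc function on an open nc set D_f of d-tuples of complex matrices, and define u(A,B) := Re f(A+iB), v(A,B) := Im f(A+iB). Let X = A + iB ∈ D_f at level n, Y = C + iD ∈ D_f at level m (A,B,C,D tuples of Hermitian matrices), and let Z be a d-tuple of n×m complex matrices such that the tuple of block upper-triangular matrices [[X, Z],[0, Y]] lies in D_f at level n+m. Then the pair of Hermitian tuples ( [[A, Z/2],[Z*/2, C]], [[B, −iZ/2],[iZ*/2, D]] ) lies in the domain of u and v, and there exist d-independent n×m complex matrices T_1 and T_2 such that u of this point equals the block matrix [[u(A,B), T_1],[T_1*, u(C,D)]] and v of this point equals [[v(A,B), T_2],[T_2*, v(C,D)]]. -/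
open Matrix Filter Topology

noncomputable section

/-- The `2 × 2` block matrix `[[P, T],[S, Q]]`, as an `(n+m) × (n+m)` matrix. -/
def bMat {n m : ℕ} (P : Matrix (Fin n) (Fin n) ℂ) (T : Matrix (Fin n) (Fin m) ℂ)
    (S : Matrix (Fin m) (Fin n) ℂ) (Q : Matrix (Fin m) (Fin m) ℂ) :
    Matrix (Fin (n + m)) (Fin (n + m)) ℂ :=
  (Matrix.fromBlocks P T S Q).submatrix finSumFinEquiv.symm finSumFinEquiv.symm

theorem bMat_mul {n m : ℕ} (P T S Q P' T' S' Q') :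
    (bMat P T S Q : Matrix (Fin (n + m)) (Fin (n + m)) ℂ) * bMat P' T' S' Q' =
      bMat (P * P' + T * S') (P * T' + T * Q') (S * P' + Q * S') (S * T' + Q * Q') := by
  unfold bMat
  rw [Matrix.submatrix_mul_equiv, Matrix.fromBlocks_multiply]

theorem bMat_one {n m : ℕ} :
    (bMat 1 0 0 1 : Matrix (Fin (n + m)) (Fin (n + m)) ℂ) = 1 := by
  unfold bMat
  rw [Matrix.fromBlocks_one, Matrix.submatrix_one_equiv]

theorem bMat_inj {n m : ℕ} {P P' : Matrix (Fin n) (Fin n) ℂ} {T T' : Matrix (Fin n) (Fin m) ℂ}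
    {S S' : Matrix (Fin m) (Fin n) ℂ} {Q Q' : Matrix (Fin m) (Fin m) ℂ}
    (h : bMat P T S Q = bMat P' T' S' Q') : P = P' ∧ T = T' ∧ S = S' ∧ Q = Q' := by
  have h2 : Matrix.fromBlocks P T S Q = Matrix.fromBlocks P' T' S' Q' := by
    have := congrArg (fun M => M.submatrix finSumFinEquiv finSumFinEquiv) h
    simpa [bMat, Matrix.submatrix_submatrix] using this
  exact Matrix.fromBlocks_inj.mp h2

theorem bMat_surj {n m : ℕ} (M : Matrix (Fin (n + m)) (Fin (n + m)) ℂ) :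
    ∃ P T S Q, M = bMat P T S Q := by
  let N := M.submatrix finSumFinEquiv finSumFinEquiv
  refine ⟨N.toBlocks₁₁, N.toBlocks₁₂, N.toBlocks₂₁, N.toBlocks₂₂, ?_⟩
  unfold bMat
  rw [Matrix.fromBlocks_toBlocks]
  simp [N, Matrix.submatrix_submatrix]

theorem bMat_conjT {n m : ℕ} (P T S Q) :
    (bMat P T S Q : Matrix (Fin (n + m)) (Fin (n + m)) ℂ)ᴴ = bMat Pᴴ Sᴴ Tᴴ Qᴴ := by
  unfold bMat
  rw [Matrix.conjTranspose_submatrix, Matrix.fromBlocks_conjTranspose]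

theorem bMat_add {n m : ℕ} (P T S Q P' T' S' Q') :
    (bMat P T S Q : Matrix (Fin (n + m)) (Fin (n + m)) ℂ) + bMat P' T' S' Q' =
      bMat (P + P') (T + T') (S + S') (Q + Q') := by
  unfold bMat
  rw [← Matrix.fromBlocks_add]; rfl

theorem bMat_smul {n m : ℕ} (c : ℂ) (P T S Q) :
    c • (bMat P T S Q : Matrix (Fin (n + m)) (Fin (n + m)) ℂ) =
      bMat (c • P) (c • T) (c • S) (c • Q) := by
  unfold bMat
  rw [← Matrix.fromBlocks_smul]; rfl

theorem intertwine {d : ℕ}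
    (DF : ∀ n : ℕ, Set (Fin d → Matrix (Fin n) (Fin n) ℂ))
    (hDFsum : ∀ n' m', ∀ X ∈ DF n', ∀ Y ∈ DF m', dSumT X Y ∈ DF (n' + m'))
    (f : ∀ n' : ℕ, (Fin d → Matrix (Fin n') (Fin n') ℂ) → Matrix (Fin n') (Fin n') ℂ)
    (hfsum : ∀ n' m', ∀ X ∈ DF n', ∀ Y ∈ DF m',
      f (n' + m') (dSumT X Y) = dSum (f n' X) (f m' Y))
    (hfsim : ∀ n', ∀ X ∈ DF n', ∀ S : Matrix (Fin n') (Fin n') ℂ, IsUnit S →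
      (fun k => S * X k * S⁻¹) ∈ DF n' →
      f n' (fun k => S * X k * S⁻¹) = S * f n' X * S⁻¹)
    {n m : ℕ} (X : Fin d → Matrix (Fin n) (Fin n) ℂ) (Y : Fin d → Matrix (Fin m) (Fin m) ℂ)
    (hX : X ∈ DF n) (hY : Y ∈ DF m) (W : Matrix (Fin n) (Fin m) ℂ)
    (h : ∀ k, X k * W = W * Y k) : f n X * W = W * f m Y := by
  have hS : (bMat 1 W 0 1 : Matrix (Fin (n + m)) (Fin (n + m)) ℂ) * bMat 1 (-W) 0 1 = 1 := by
    rw [bMat_mul, ← bMat_one]; simp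
  have hinv := Matrix.inv_eq_right_inv hS
  have hu : IsUnit (bMat 1 W 0 1 : Matrix (Fin (n + m)) (Fin (n + m)) ℂ) :=
    IsUnit.of_mul_eq_one _ hS
  have hd : ∀ (P : Matrix (Fin n) (Fin n) ℂ) (Q : Matrix (Fin m) (Fin m) ℂ),
      dSum P Q = bMat P 0 0 Q := fun _ _ => rfl
  have hc : ∀ (P : Matrix (Fin n) (Fin n) ℂ) (Q : Matrix (Fin m) (Fin m) ℂ),
      bMat 1 W 0 1 * dSum P Q * (bMat 1 W 0 1)⁻¹ = bMat P (-(P * W) + W * Q) 0 Q := by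
    intro P Q
    rw [hinv, hd, bMat_mul, bMat_mul]; simp
  have he : (fun k => bMat 1 W 0 1 * dSumT X Y k * (bMat 1 W 0 1)⁻¹) = dSumT X Y := by
    funext k
    unfold dSumT
    rw [hc, h k, hd]; simp
  have hmem := hDFsum n m X hX Y hY
  have key := hfsim (n + m) (dSumT X Y) hmem (bMat 1 W 0 1) hu (by rw [he]; exact hmem)
  rw [he, hfsum n m X hX Y hY, hc, hd] at key
  have h2 := (bMat_inj key).2.1
  exact (neg_add_eq_zero.mp h2.symm)

theorem upper_tri {d : ℕ}
    (DF : ∀ n : ℕ, Set (Fin d → Matrix (Fin n) (Fin n) ℂ))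
    (hDFsum : ∀ n' m', ∀ X ∈ DF n', ∀ Y ∈ DF m', dSumT X Y ∈ DF (n' + m'))
    (f : ∀ n' : ℕ, (Fin d → Matrix (Fin n') (Fin n') ℂ) → Matrix (Fin n') (Fin n') ℂ)
    (hfsum : ∀ n' m', ∀ X ∈ DF n', ∀ Y ∈ DF m',
      f (n' + m') (dSumT X Y) = dSum (f n' X) (f m' Y))
    (hfsim : ∀ n', ∀ X ∈ DF n', ∀ S : Matrix (Fin n') (Fin n') ℂ, IsUnit S →
      (fun k => S * X k * S⁻¹) ∈ DF n' →
      f n' (fun k => S * X k * S⁻¹) = S * f n' X * S⁻¹)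
    {n m : ℕ} (X : Fin d → Matrix (Fin n) (Fin n) ℂ) (Y : Fin d → Matrix (Fin m) (Fin m) ℂ)
    (hX : X ∈ DF n) (hY : Y ∈ DF m) (Z : Fin d → Matrix (Fin n) (Fin m) ℂ)
    (hUT : (fun k => bMat (X k) (Z k) 0 (Y k)) ∈ DF (n + m)) :
    ∃ T, f (n + m) (fun k => bMat (X k) (Z k) 0 (Y k)) = bMat (f n X) T 0 (f m Y) := by
  obtain ⟨P, T, S, Q, hM⟩ := bMat_surj (f (n + m) (fun k => bMat (X k) (Z k) 0 (Y k)))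
  let J : Matrix (Fin (n + m)) (Fin n) ℂ :=
    (Matrix.fromRows 1 0 : Matrix (Fin n ⊕ Fin m) (Fin n) ℂ).submatrix finSumFinEquiv.symm id
  let K : Matrix (Fin m) (Fin (n + m)) ℂ :=
    (Matrix.fromCols 0 1 : Matrix (Fin m) (Fin n ⊕ Fin m) ℂ).submatrix id finSumFinEquiv.symm
  have hJ : ∀ (P : Matrix (Fin n) (Fin n) ℂ) (T : Matrix (Fin n) (Fin m) ℂ) (S : Matrix (Fin m) (Fin n) ℂ)
      (Q : Matrix (Fin m) (Fin m) ℂ), bMat P T S Q * J =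
      (Matrix.fromRows P S).submatrix finSumFinEquiv.symm id := by
    intro P T S Q
    simp only [bMat, J]
    rw [Matrix.submatrix_mul_equiv, Matrix.fromBlocks_mul_fromRows]; simp
  have hJ' : ∀ P : Matrix (Fin n) (Fin n) ℂ, J * P =
      (Matrix.fromRows P 0).submatrix finSumFinEquiv.symm id := by
    intro P
    have : J * P = J * P.submatrix (Equiv.refl _) id := rfl
    rw [this]
    have h3 := Matrix.submatrix_mul_equiv (Matrix.fromRows 1 0 : Matrix (Fin n ⊕ Fin m) (Fin n) ℂ)
      P finSumFinEquiv.symm (Equiv.refl _) id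
    refine h3.trans ?_
    rw [Matrix.fromRows_mul]; simp
  have hK : ∀ (P : Matrix (Fin n) (Fin n) ℂ) (T : Matrix (Fin n) (Fin m) ℂ) (S : Matrix (Fin m) (Fin n) ℂ)
      (Q : Matrix (Fin m) (Fin m) ℂ), K * bMat P T S Q =
      (Matrix.fromCols S Q).submatrix id finSumFinEquiv.symm := by
    intro P T S Q
    simp only [bMat, K]
    rw [Matrix.submatrix_mul_equiv, Matrix.fromCols_mul_fromBlocks]; simp
  have hK' : ∀ Q : Matrix (Fin m) (Fin m) ℂ, Q * K =
      (Matrix.fromCols 0 Q).submatrix id finSumFinEquiv.symm := by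
    intro Q
    have h3 := Matrix.submatrix_mul_equiv Q
      (Matrix.fromCols 0 1 : Matrix (Fin m) (Fin n ⊕ Fin m) ℂ) id (Equiv.refl _)
      finSumFinEquiv.symm
    refine Eq.trans h3 ?_
    rw [Matrix.mul_fromCols]; simp
  have h1 := intertwine DF hDFsum f hfsum hfsim _ X hUT hX J (by
    intro k; rw [hJ, hJ'])
  have h2 := intertwine DF hDFsum f hfsum hfsim Y _ hY hUT K (by
    intro k; rw [hK, hK'])
  rw [hM, hJ, hJ'] at h1
  rw [hM, hK, hK'] at h2
  have h1' : Matrix.fromRows P S = Matrix.fromRows (f n X) 0 := by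
    have := congrArg (fun M => M.submatrix finSumFinEquiv id) h1
    simpa [Matrix.submatrix_submatrix] using this
  have h2' : Matrix.fromCols 0 (f m Y) = Matrix.fromCols S Q := by
    have := congrArg (fun M => M.submatrix id finSumFinEquiv) h2
    simpa [Matrix.submatrix_submatrix] using this
  obtain ⟨hP, hS⟩ := Matrix.fromRows_inj h1'
  obtain ⟨_, hQ⟩ := Matrix.fromCols_inj h2'
  exact ⟨T, by rw [hM, hP, hS, hQ]⟩

/-- The real and imaginary parts of an nc function "respect diagonals" at the
Hermitian point associated with a block upper triangular point of the domain. -/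
theorem re_im_respect_diagonals (d : ℕ)
    (DF : ∀ n : ℕ, Set (Fin d → Matrix (Fin n) (Fin n) ℂ))
    (hDFsum : ∀ n' m', ∀ X ∈ DF n', ∀ Y ∈ DF m', dSumT X Y ∈ DF (n' + m'))
    (hDFopen : ∀ n', IsOpen (DF n'))
    (f : ∀ n' : ℕ, (Fin d → Matrix (Fin n') (Fin n') ℂ) → Matrix (Fin n') (Fin n') ℂ)
    (hfsum : ∀ n' m', ∀ X ∈ DF n', ∀ Y ∈ DF m',
      f (n' + m') (dSumT X Y) = dSum (f n' X) (f m' Y))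
    (hfsim : ∀ n', ∀ X ∈ DF n', ∀ S : Matrix (Fin n') (Fin n') ℂ, IsUnit S →
      (fun k => S * X k * S⁻¹) ∈ DF n' →
      f n' (fun k => S * X k * S⁻¹) = S * f n' X * S⁻¹)
    (n m : ℕ)
    (A B : Fin d → Matrix (Fin n) (Fin n) ℂ) (C E : Fin d → Matrix (Fin m) (Fin m) ℂ)
    (hA : ∀ k, (A k).IsHermitian) (hB : ∀ k, (B k).IsHermitian)
    (hC : ∀ k, (C k).IsHermitian) (hE : ∀ k, (E k).IsHermitian)
    (Z : Fin d → Matrix (Fin n) (Fin m) ℂ)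
    (hX : cmb A B ∈ DF n) (hY : cmb C E ∈ DF m)
    (hUT : (fun k => bMat (A k + Complex.I • B k) (Z k) 0 (C k + Complex.I • E k)) ∈
      DF (n + m)) :
    -- the Hermitian pair built from the block point lies in the domain of `u` and `v`:
    (∀ k, (bMat (A k) ((2⁻¹ : ℂ) • Z k) ((2⁻¹ : ℂ) • (Z k)ᴴ) (C k)).IsHermitian) ∧
    (∀ k, (bMat (B k) ((-(2⁻¹ * Complex.I)) • Z k) ((2⁻¹ * Complex.I) • (Z k)ᴴ)
      (E k)).IsHermitian) ∧
    cmb (fun k => bMat (A k) ((2⁻¹ : ℂ) • Z k) ((2⁻¹ : ℂ) • (Z k)ᴴ) (C k))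
        (fun k => bMat (B k) ((-(2⁻¹ * Complex.I)) • Z k) ((2⁻¹ * Complex.I) • (Z k)ᴴ) (E k))
      ∈ DF (n + m) ∧
    -- `u` and `v` respect diagonals at this point:
    ∃ T1 T2 : Matrix (Fin n) (Fin m) ℂ,
      reM (f (n + m)
          (cmb (fun k => bMat (A k) ((2⁻¹ : ℂ) • Z k) ((2⁻¹ : ℂ) • (Z k)ᴴ) (C k))
            (fun k => bMat (B k) ((-(2⁻¹ * Complex.I)) • Z k) ((2⁻¹ * Complex.I) • (Z k)ᴴ)
              (E k)))) =
        bMat (reM (f n (cmb A B))) T1 T1ᴴ (reM (f m (cmb C E))) ∧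
      imM (f (n + m)
          (cmb (fun k => bMat (A k) ((2⁻¹ : ℂ) • Z k) ((2⁻¹ : ℂ) • (Z k)ᴴ) (C k))
            (fun k => bMat (B k) ((-(2⁻¹ * Complex.I)) • Z k) ((2⁻¹ * Complex.I) • (Z k)ᴴ)
              (E k)))) =
        bMat (imM (f n (cmb A B))) T2 T2ᴴ (imM (f m (cmb C E))) := by
  have hcmb : cmb (fun k => bMat (A k) ((2⁻¹ : ℂ) • Z k) ((2⁻¹ : ℂ) • (Z k)ᴴ) (C k))
        (fun k => bMat (B k) ((-(2⁻¹ * Complex.I)) • Z k) ((2⁻¹ * Complex.I) • (Z k)ᴴ) (E k))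
      = fun k => bMat (cmb A B k) (Z k) 0 (cmb C E k) := by
    funext k
    have e1 : Complex.I * -(2⁻¹ * Complex.I) = 2⁻¹ := by
      linear_combination (-2⁻¹ : ℂ) * Complex.I_mul_I
    have e2 : Complex.I * (2⁻¹ * Complex.I) = -2⁻¹ := by
      linear_combination (2⁻¹ : ℂ) * Complex.I_mul_I
    simp only [cmb]
    rw [bMat_smul, bMat_add, smul_smul, smul_smul, e1, e2, ← add_smul, ← add_smul]
    norm_num
  obtain ⟨T, hT⟩ := upper_tri DF hDFsum f hfsum hfsim (cmb A B) (cmb C E) hX hY Z hUT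
  rw [hcmb]
  refine ⟨?_, ?_, hUT, (2⁻¹ : ℂ) • T, (2 * Complex.I)⁻¹ • T, ?_, ?_⟩
  · intro k
    unfold Matrix.IsHermitian
    rw [bMat_conjT, (hA k).eq, (hC k).eq]
    simp [Matrix.conjTranspose_smul]
  · intro k
    unfold Matrix.IsHermitian
    rw [bMat_conjT, (hB k).eq, (hE k).eq]
    simp [Matrix.conjTranspose_smul, mul_comm]
  · rw [hT]
    unfold reM
    rw [bMat_conjT, bMat_add, bMat_smul]
    simp [Matrix.conjTranspose_smul]
  · rw [hT]
    unfold imM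
    rw [bMat_conjT, sub_eq_add_neg, ← neg_one_smul ℂ (bMat _ _ _ _), bMat_smul, bMat_add, bMat_smul]
    simp [Matrix.conjTranspose_smul, sub_eq_add_neg]
end
end

section
/- Let u and v be Fréchet differentiable real nc functions on open nc sets of pairs of d-tuples of Hermitian matrices satisfying the nc Cauchy–Riemann equations Du(A,B)(Z_1,Z_2) = Dv(A,B)(−Z_2,Z_1) on the common domain D, and define f(A+iB) := u(A,B) + i v(A,B) on D_f := {A+iB : (A,B) ∈ D}. Then f is Fréchet differentiable at every X = A+iB ∈ D_f, with derivative the ℂ-linear map Df(X)(Z_1+iZ_2) = Du(A,B)(Z_1,Z_2) + i Dv(A,B)(Z_1,Z_2); that is, ‖f(X+Z) − f(X) − Df(X)(Z)‖/‖Z‖ → 0 as ‖Z‖ → 0. -/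
open Matrix Filter Topology

noncomputable section

/-- The norm of a pair of tuples of matrices: the maximum of the operator norms of the
entries. -/
def pNorm {d n : ℕ} (Z1 Z2 : Fin d → Matrix (Fin n) (Fin n) ℂ) : ℝ :=
  ⨆ k, max (opNorm (Z1 k)) (opNorm (Z2 k))

/-- The norm of the complex tuple `Z₁ + iZ₂`: the maximum of the operator norms of the
entries. -/
def cNorm {d n : ℕ} (Z1 Z2 : Fin d → Matrix (Fin n) (Fin n) ℂ) : ℝ :=
  ⨆ k, opNorm (Z1 k + Complex.I • Z2 k)

section Helpers
open scoped Matrix.Norms.L2Operator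

theorem opNorm_eq_l2 {m n : ℕ} (M : Matrix (Fin m) (Fin n) ℂ) : opNorm M = ‖M‖ := by
  rw [Matrix.l2_opNorm_def]; rfl

theorem opNorm_nonneg' {m n : ℕ} (M : Matrix (Fin m) (Fin n) ℂ) : 0 ≤ opNorm M := by
  rw [opNorm_eq_l2]; exact norm_nonneg _

theorem opNorm_add_I_le {n : ℕ} (A B : Matrix (Fin n) (Fin n) ℂ) :
    opNorm (A + Complex.I • B) ≤ opNorm A + opNorm B := by
  simp only [opNorm_eq_l2]
  refine (norm_add_le _ _).trans ?_
  rw [norm_smul, Complex.norm_I, one_mul]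

theorem opNorm_pos_of_ne {n : ℕ} {A : Matrix (Fin n) (Fin n) ℂ} (h : A ≠ 0) : 0 < opNorm A := by
  rw [opNorm_eq_l2]; exact norm_pos_iff.2 h

theorem conj_parts {n : ℕ} {A B : Matrix (Fin n) (Fin n) ℂ} (hA : A.IsHermitian)
    (hB : B.IsHermitian) : (A + Complex.I • B)ᴴ = A - Complex.I • B := by
  rw [Matrix.conjTranspose_add, Matrix.conjTranspose_smul, hA.eq, hB.eq]
  simp [sub_eq_add_neg]

theorem re_norm_le {n : ℕ} {A B : Matrix (Fin n) (Fin n) ℂ} (hA : A.IsHermitian)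
    (hB : B.IsHermitian) : opNorm A ≤ opNorm (A + Complex.I • B) := by
  simp only [opNorm_eq_l2]
  have h1 : (2 : ℂ) • A = (A + Complex.I • B) + (A + Complex.I • B)ᴴ := by
    rw [conj_parts hA hB, two_smul]; abel
  have h2 := norm_add_le (A + Complex.I • B) ((A + Complex.I • B)ᴴ)
  rw [← h1, Matrix.l2_opNorm_conjTranspose, norm_smul] at h2
  norm_num at h2
  linarith

theorem im_norm_le {n : ℕ} {A B : Matrix (Fin n) (Fin n) ℂ} (hA : A.IsHermitian)
    (hB : B.IsHermitian) : opNorm B ≤ opNorm (A + Complex.I • B) := by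
  simp only [opNorm_eq_l2]
  have h1 : (2 * Complex.I : ℂ) • B = (A + Complex.I • B) - (A + Complex.I • B)ᴴ := by
    rw [conj_parts hA hB, mul_smul, two_smul]; abel
  have h2 := norm_sub_le (A + Complex.I • B) ((A + Complex.I • B)ᴴ)
  rw [← h1, Matrix.l2_opNorm_conjTranspose, norm_smul] at h2
  norm_num at h2
  linarith

theorem herm_unique {n : ℕ} {A B C D : Matrix (Fin n) (Fin n) ℂ} (hA : A.IsHermitian)
    (hB : B.IsHermitian) (hC : C.IsHermitian) (hD : D.IsHermitian)
    (h : A + Complex.I • B = C + Complex.I • D) : A = C ∧ B = D := by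
  have hs : (A - C) + Complex.I • (B - D) = 0 := by
    rw [smul_sub]
    have : A - C + (Complex.I • B - Complex.I • D)
      = (A + Complex.I • B) - (C + Complex.I • D) := by abel
    rw [this, h, sub_self]
  have h1 := re_norm_le (hA.sub hC) (hB.sub hD)
  have h2 := im_norm_le (hA.sub hC) (hB.sub hD)
  simp only [hs, opNorm_eq_l2, norm_zero] at h1 h2
  exact ⟨sub_eq_zero.1 (norm_le_zero_iff.1 h1), sub_eq_zero.1 (norm_le_zero_iff.1 h2)⟩

theorem pNorm_le_cNorm {d n : ℕ} (hd : 0 < d) {Z1 Z2 : Fin d → Matrix (Fin n) (Fin n) ℂ}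
    (h1 : ∀ k, (Z1 k).IsHermitian) (h2 : ∀ k, (Z2 k).IsHermitian) :
    pNorm Z1 Z2 ≤ cNorm Z1 Z2 := by
  unfold pNorm cNorm
  exact ciSup_mono (Set.finite_range _).bddAbove
    (fun k => max_le (re_norm_le (h1 k) (h2 k)) (im_norm_le (h1 k) (h2 k)))

theorem pNorm_pos {d n : ℕ} {Z1 Z2 : Fin d → Matrix (Fin n) (Fin n) ℂ}
    (h : ¬(Z1 = 0 ∧ Z2 = 0)) : 0 < pNorm Z1 Z2 := by
  have key : ∃ k, 0 < max (opNorm (Z1 k)) (opNorm (Z2 k)) := by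
    by_contra hc
    push Not at hc
    refine h ⟨?_, ?_⟩ <;> funext k <;> by_contra hk
    · exact absurd (hc k) (not_le.2 (lt_max_of_lt_left (opNorm_pos_of_ne hk)))
    · exact absurd (hc k) (not_le.2 (lt_max_of_lt_right (opNorm_pos_of_ne hk)))
  obtain ⟨k, hk⟩ := key
  exact hk.trans_le (le_ciSup (f := fun k => max (opNorm (Z1 k)) (opNorm (Z2 k)))
    (Set.finite_range _).bddAbove k)

end Helpers

/-- If `u`, `v` are Fréchet differentiable real nc functions satisfying the
nc Cauchy–Riemann equations, then `f = u + iv` is Fréchet differentiable at every point, with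
derivative the ℂ-linear map `Df(X)(Z₁+iZ₂) = Du(A,B)(Z₁,Z₂) + i Dv(A,B)(Z₁,Z₂)`. -/
theorem f_from_u_v_frechet (d : ℕ) (hd : 0 < d)
    (Du_dom : ∀ n : ℕ, Set ((Fin d → Matrix (Fin n) (Fin n) ℂ) ×
      (Fin d → Matrix (Fin n) (Fin n) ℂ)))
    (hDu_domherm : ∀ n, ∀ P ∈ Du_dom n,
      (∀ k, (Prod.fst P k).IsHermitian) ∧ (∀ k, (Prod.snd P k).IsHermitian))
    (hDu_domsum : ∀ n m, ∀ P ∈ Du_dom n, ∀ Q ∈ Du_dom m,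
      (dSumT (Prod.fst P) (Prod.fst Q), dSumT (Prod.snd P) (Prod.snd Q)) ∈ Du_dom (n + m))
    (u : ∀ n : ℕ, ((Fin d → Matrix (Fin n) (Fin n) ℂ) ×
      (Fin d → Matrix (Fin n) (Fin n) ℂ)) → Matrix (Fin n) (Fin n) ℂ)
    (huherm : ∀ n, ∀ P ∈ Du_dom n, (u n P).IsHermitian)
    (husum : ∀ n m, ∀ P ∈ Du_dom n, ∀ Q ∈ Du_dom m,
      u (n + m) (dSumT (Prod.fst P) (Prod.fst Q), dSumT (Prod.snd P) (Prod.snd Q)) =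
        dSum (u n P) (u m Q))
    (huu : ∀ n, ∀ P ∈ Du_dom n, ∀ U : Matrix (Fin n) (Fin n) ℂ,
      U ∈ Matrix.unitaryGroup (Fin n) ℂ →
      ((fun k => U * Prod.fst P k * star U), (fun k => U * Prod.snd P k * star U)) ∈ Du_dom n →
      u n ((fun k => U * Prod.fst P k * star U), (fun k => U * Prod.snd P k * star U)) =
        U * u n P * star U)
    (hDu_domopen : ∀ n, ∀ P ∈ Du_dom n, ∃ ε > (0 : ℝ),
      ∀ Q : (Fin d → Matrix (Fin n) (Fin n) ℂ) × (Fin d → Matrix (Fin n) (Fin n) ℂ),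
        (∀ k, (Prod.fst Q k).IsHermitian) → (∀ k, (Prod.snd Q k).IsHermitian) →
        (∀ k, opNorm (Prod.fst Q k - Prod.fst P k) < ε) →
        (∀ k, opNorm (Prod.snd Q k - Prod.snd P k) < ε) → Q ∈ Du_dom n)
    (Dv_dom : ∀ n : ℕ, Set ((Fin d → Matrix (Fin n) (Fin n) ℂ) ×
      (Fin d → Matrix (Fin n) (Fin n) ℂ)))
    (hDv_domherm : ∀ n, ∀ P ∈ Dv_dom n,
      (∀ k, (Prod.fst P k).IsHermitian) ∧ (∀ k, (Prod.snd P k).IsHermitian))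
    (hDv_domsum : ∀ n m, ∀ P ∈ Dv_dom n, ∀ Q ∈ Dv_dom m,
      (dSumT (Prod.fst P) (Prod.fst Q), dSumT (Prod.snd P) (Prod.snd Q)) ∈ Dv_dom (n + m))
    (v : ∀ n : ℕ, ((Fin d → Matrix (Fin n) (Fin n) ℂ) ×
      (Fin d → Matrix (Fin n) (Fin n) ℂ)) → Matrix (Fin n) (Fin n) ℂ)
    (hvherm : ∀ n, ∀ P ∈ Dv_dom n, (v n P).IsHermitian)
    (hvsum : ∀ n m, ∀ P ∈ Dv_dom n, ∀ Q ∈ Dv_dom m,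
      v (n + m) (dSumT (Prod.fst P) (Prod.fst Q), dSumT (Prod.snd P) (Prod.snd Q)) =
        dSum (v n P) (v m Q))
    (hvu : ∀ n, ∀ P ∈ Dv_dom n, ∀ U : Matrix (Fin n) (Fin n) ℂ,
      U ∈ Matrix.unitaryGroup (Fin n) ℂ →
      ((fun k => U * Prod.fst P k * star U), (fun k => U * Prod.snd P k * star U)) ∈ Dv_dom n →
      v n ((fun k => U * Prod.fst P k * star U), (fun k => U * Prod.snd P k * star U)) =
        U * v n P * star U)
    (hDv_domopen : ∀ n, ∀ P ∈ Dv_dom n, ∃ ε > (0 : ℝ),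
      ∀ Q : (Fin d → Matrix (Fin n) (Fin n) ℂ) × (Fin d → Matrix (Fin n) (Fin n) ℂ),
        (∀ k, (Prod.fst Q k).IsHermitian) → (∀ k, (Prod.snd Q k).IsHermitian) →
        (∀ k, opNorm (Prod.fst Q k - Prod.fst P k) < ε) →
        (∀ k, opNorm (Prod.snd Q k - Prod.snd P k) < ε) → Q ∈ Dv_dom n)
    (Du : ∀ n : ℕ, ((Fin d → Matrix (Fin n) (Fin n) ℂ) ×
        (Fin d → Matrix (Fin n) (Fin n) ℂ)) →
      ((Fin d → Matrix (Fin n) (Fin n) ℂ) × (Fin d → Matrix (Fin n) (Fin n) ℂ)) →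
      Matrix (Fin n) (Fin n) ℂ)
    (hDuadd : ∀ n, ∀ P ∈ Du_dom n, ∀ Z1 Z2 W1 W2 : Fin d → Matrix (Fin n) (Fin n) ℂ,
      (∀ k, (Z1 k).IsHermitian) → (∀ k, (Z2 k).IsHermitian) →
      (∀ k, (W1 k).IsHermitian) → (∀ k, (W2 k).IsHermitian) →
      Du n P (Z1 + W1, Z2 + W2) = Du n P (Z1, Z2) + Du n P (W1, W2))
    (hDusmul : ∀ n, ∀ P ∈ Du_dom n, ∀ (t : ℝ) (Z1 Z2 : Fin d → Matrix (Fin n) (Fin n) ℂ),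
      (∀ k, (Z1 k).IsHermitian) → (∀ k, (Z2 k).IsHermitian) →
      Du n P (t • Z1, t • Z2) = t • Du n P (Z1, Z2))
    (hDuF : ∀ n, ∀ P ∈ Du_dom n, ∀ ε > (0 : ℝ), ∃ δ > (0 : ℝ),
      ∀ Z1 Z2 : Fin d → Matrix (Fin n) (Fin n) ℂ,
        (∀ k, (Z1 k).IsHermitian) → (∀ k, (Z2 k).IsHermitian) →
        ¬(Z1 = 0 ∧ Z2 = 0) → pNorm Z1 Z2 < δ →
        opNorm (u n (P + (Z1, Z2)) - u n P - Du n P (Z1, Z2)) / pNorm Z1 Z2 < ε)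
    (Dv : ∀ n : ℕ, ((Fin d → Matrix (Fin n) (Fin n) ℂ) ×
        (Fin d → Matrix (Fin n) (Fin n) ℂ)) →
      ((Fin d → Matrix (Fin n) (Fin n) ℂ) × (Fin d → Matrix (Fin n) (Fin n) ℂ)) →
      Matrix (Fin n) (Fin n) ℂ)
    (hDvadd : ∀ n, ∀ P ∈ Dv_dom n, ∀ Z1 Z2 W1 W2 : Fin d → Matrix (Fin n) (Fin n) ℂ,
      (∀ k, (Z1 k).IsHermitian) → (∀ k, (Z2 k).IsHermitian) →
      (∀ k, (W1 k).IsHermitian) → (∀ k, (W2 k).IsHermitian) →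
      Dv n P (Z1 + W1, Z2 + W2) = Dv n P (Z1, Z2) + Dv n P (W1, W2))
    (hDvsmul : ∀ n, ∀ P ∈ Dv_dom n, ∀ (t : ℝ) (Z1 Z2 : Fin d → Matrix (Fin n) (Fin n) ℂ),
      (∀ k, (Z1 k).IsHermitian) → (∀ k, (Z2 k).IsHermitian) →
      Dv n P (t • Z1, t • Z2) = t • Dv n P (Z1, Z2))
    (hDvF : ∀ n, ∀ P ∈ Dv_dom n, ∀ ε > (0 : ℝ), ∃ δ > (0 : ℝ),
      ∀ Z1 Z2 : Fin d → Matrix (Fin n) (Fin n) ℂ,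
        (∀ k, (Z1 k).IsHermitian) → (∀ k, (Z2 k).IsHermitian) →
        ¬(Z1 = 0 ∧ Z2 = 0) → pNorm Z1 Z2 < δ →
        opNorm (v n (P + (Z1, Z2)) - v n P - Dv n P (Z1, Z2)) / pNorm Z1 Z2 < ε)
    (hCR : ∀ n, ∀ P, P ∈ Du_dom n → P ∈ Dv_dom n →
      ∀ Z1 Z2 : Fin d → Matrix (Fin n) (Fin n) ℂ,
        (∀ k, (Z1 k).IsHermitian) → (∀ k, (Z2 k).IsHermitian) →
        Du n P (Z1, Z2) = Dv n P (-Z2, Z1)) :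
    ∀ n, ∀ P, P ∈ Du_dom n → P ∈ Dv_dom n →
      -- the derivative `Df(X)(Z₁+iZ₂) = Du(A,B)(Z₁,Z₂) + i Dv(A,B)(Z₁,Z₂)` is ℂ-homogeneous
      -- (and hence, being additive, ℂ-linear):
      (∀ (z : ℂ) (Z1 Z2 Z1' Z2' : Fin d → Matrix (Fin n) (Fin n) ℂ),
        (∀ k, (Z1 k).IsHermitian) → (∀ k, (Z2 k).IsHermitian) →
        (∀ k, (Z1' k).IsHermitian) → (∀ k, (Z2' k).IsHermitian) →
        (∀ k, Z1' k + Complex.I • Z2' k = z • (Z1 k + Complex.I • Z2 k)) →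
        Du n P (Z1', Z2') + Complex.I • Dv n P (Z1', Z2') =
          z • (Du n P (Z1, Z2) + Complex.I • Dv n P (Z1, Z2))) ∧
      -- `f` is Fréchet differentiable at `X = A + iB` with this derivative:
      (∀ ε > (0 : ℝ), ∃ δ > (0 : ℝ), ∀ Z1 Z2 : Fin d → Matrix (Fin n) (Fin n) ℂ,
        (∀ k, (Z1 k).IsHermitian) → (∀ k, (Z2 k).IsHermitian) →
        ¬(Z1 = 0 ∧ Z2 = 0) → cNorm Z1 Z2 < δ →
        opNorm ((u n (P + (Z1, Z2)) + Complex.I • v n (P + (Z1, Z2))) -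
            (u n P + Complex.I • v n P) -
            (Du n P (Z1, Z2) + Complex.I • Dv n P (Z1, Z2))) / cNorm Z1 Z2 < ε) := by
  intro n P hPu hPv
  have hsm : ∀ (t : ℝ) (Z : Fin d → Matrix (Fin n) (Fin n) ℂ), (∀ k, (Z k).IsHermitian) →
      ∀ k, ((t • Z) k).IsHermitian := by
    intro t Z hZ k
    rw [Pi.smul_apply, Matrix.IsHermitian, Matrix.conjTranspose_smul, (hZ k).eq, star_trivial]
  refine ⟨?_, ?_⟩
  · intro z Z1 Z2 Z1' Z2' h1 h2 h1' h2' hz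
    have hn2 : ∀ k, ((-Z2) k).IsHermitian := fun k => (h2 k).neg
    have hn1 : ∀ k, ((-Z1) k).IsHermitian := fun k => (h1 k).neg
    have e : ∀ k, Z1' k = (z.re • Z1 + z.im • (-Z2)) k ∧ Z2' k = (z.re • Z2 + z.im • Z1) k := by
      intro k
      refine herm_unique (h1' k) (h2' k) ((hsm _ _ h1 k).add (hsm _ _ hn2 k))
        ((hsm _ _ h2 k).add (hsm _ _ h1 k)) ?_
      rw [hz k]
      ext i j
      simp only [Pi.add_apply, Pi.smul_apply, Pi.neg_apply, Matrix.add_apply, Matrix.smul_apply,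
        Matrix.neg_apply, smul_eq_mul, Complex.real_smul]
      conv_lhs => rw [← Complex.re_add_im z]
      linear_combination (z.im : ℂ) * Z2 k i j * Complex.I_mul_I
    have e1 : Z1' = z.re • Z1 + z.im • (-Z2) := funext fun k => (e k).1
    have e2 : Z2' = z.re • Z2 + z.im • Z1 := funext fun k => (e k).2
    rw [e1, e2, hDuadd n P hPu _ _ _ _ (hsm _ _ h1) (hsm _ _ h2) (hsm _ _ hn2) (hsm _ _ h1),
      hDvadd n P hPv _ _ _ _ (hsm _ _ h1) (hsm _ _ h2) (hsm _ _ hn2) (hsm _ _ h1),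
      hDusmul n P hPu _ _ _ h1 h2, hDusmul n P hPu _ _ _ hn2 h1,
      hDvsmul n P hPv _ _ _ h1 h2, hDvsmul n P hPv _ _ _ hn2 h1,
      ← hCR n P hPu hPv Z1 Z2 h1 h2, hCR n P hPu hPv (-Z2) Z1 hn2 h1]
    have e3 : Dv n P (-Z1, -Z2) = - Dv n P (Z1, Z2) := by
      have := hDvsmul n P hPv (-1) Z1 Z2 h1 h2
      simpa using this
    rw [e3]
    ext i j
    simp only [Matrix.add_apply, Matrix.smul_apply, Matrix.neg_apply, smul_eq_mul,
      Complex.real_smul]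
    conv_rhs => rw [← Complex.re_add_im z]
    linear_combination -(z.im : ℂ) * Dv n P (Z1, Z2) i j * Complex.I_mul_I
  · intro ε hε
    obtain ⟨δ1, hδ1, H1⟩ := hDuF n P hPu (ε / 2) (half_pos hε)
    obtain ⟨δ2, hδ2, H2⟩ := hDvF n P hPv (ε / 2) (half_pos hε)
    refine ⟨min δ1 δ2, lt_min hδ1 hδ2, ?_⟩
    intro Z1 Z2 h1 h2 hne hc
    have hpc := pNorm_le_cNorm hd h1 h2
    have hp := pNorm_pos hne
    have a1 := H1 Z1 Z2 h1 h2 hne (hpc.trans_lt (hc.trans_le (min_le_left _ _)))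
    have a2 := H2 Z1 Z2 h1 h2 hne (hpc.trans_lt (hc.trans_le (min_le_right _ _)))
    rw [div_lt_iff₀ hp] at a1 a2
    rw [div_lt_iff₀ (hp.trans_le hpc)]
    have e : (u n (P + (Z1, Z2)) + Complex.I • v n (P + (Z1, Z2))) -
            (u n P + Complex.I • v n P) -
            (Du n P (Z1, Z2) + Complex.I • Dv n P (Z1, Z2)) =
        (u n (P + (Z1, Z2)) - u n P - Du n P (Z1, Z2)) +
          Complex.I • (v n (P + (Z1, Z2)) - v n P - Dv n P (Z1, Z2)) := by
      rw [smul_sub, smul_sub]; abel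
    rw [e]
    have b := opNorm_add_I_le (u n (P + (Z1, Z2)) - u n P - Du n P (Z1, Z2))
      (v n (P + (Z1, Z2)) - v n P - Dv n P (Z1, Z2))
    have c := mul_le_mul_of_nonneg_left hpc hε.le
    linarith
end
end

section
/- Let u and v be Fréchet differentiable real nc functions on open nc sets of pairs of d-tuples of Hermitian matrices satisfying the nc Cauchy–Riemann equations Du(A,B)(Z_1,Z_2) = Dv(A,B)(−Z_2,Z_1) on the common domain D, and define f(A+iB) := u(A,B) + i v(A,B) on D_f := {A+iB : (A,B) ∈ D}. Then for every n, every X ∈ D_f at level n, and every n×n complex matrix T, one has Df(X)([T,X]) = [T, f(X)], where [T,X] denotes the entrywise commutator tuple (T X^{(k)} − X^{(k)} T)_k and [T, f(X)] = T f(X) − f(X) T. -/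
open Matrix Filter Topology

noncomputable section

section helpers
open scoped Matrix.Norms.L2Operator

lemma opNorm_eq_aux {n : ℕ} (M : Matrix (Fin n) (Fin n) ℂ) : opNorm M = ‖M‖ := rfl

/-- Hermitian part as a real linear map. -/
def hPart (n : ℕ) : Matrix (Fin n) (Fin n) ℂ →ₗ[ℝ] Matrix (Fin n) (Fin n) ℂ where
  toFun M := (1/2 : ℝ) • (M + star M)
  map_add' a b := by rw [star_add, ← smul_add]; congr 1; abel
  map_smul' t a := by
    rw [star_smul, star_trivial, ← smul_add, smul_comm]; rfl

lemma hPart_apply {n : ℕ} (M : Matrix (Fin n) (Fin n) ℂ) :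
    hPart n M = (1/2 : ℝ) • (M + star M) := rfl

lemma hPart_herm {n : ℕ} (M : Matrix (Fin n) (Fin n) ℂ) : (hPart n M).IsHermitian := by
  change star _ = _
  rw [hPart_apply, star_smul, star_add, star_star, add_comm]; simp

lemma hPart_of_herm {n : ℕ} {M : Matrix (Fin n) (Fin n) ℂ} (h : M.IsHermitian) :
    hPart n M = M := by
  have h' : star M = M := h
  rw [hPart_apply, h', ← two_smul ℝ, smul_smul]; norm_num

lemma hPart_norm {n : ℕ} (M : Matrix (Fin n) (Fin n) ℂ) : ‖hPart n M‖ ≤ ‖M‖ := by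
  rw [hPart_apply]
  calc _ ≤ ‖(1/2:ℝ)‖ * ‖M + star M‖ := norm_smul_le _ _
    _ ≤ ‖(1/2:ℝ)‖ * (‖M‖ + ‖star M‖) := by gcongr; exact norm_add_le _ _
    _ = ‖M‖ := by rw [norm_star]; norm_num; ring

lemma skew_case (d n : ℕ) (hd : 0 < d)
    (dom : Set ((Fin d → Matrix (Fin n) (Fin n) ℂ) × (Fin d → Matrix (Fin n) (Fin n) ℂ)))
    (hherm : ∀ P ∈ dom,
      (∀ k, (Prod.fst P k).IsHermitian) ∧ (∀ k, (Prod.snd P k).IsHermitian))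
    (u : ((Fin d → Matrix (Fin n) (Fin n) ℂ) ×
      (Fin d → Matrix (Fin n) (Fin n) ℂ)) → Matrix (Fin n) (Fin n) ℂ)
    (huu : ∀ P ∈ dom, ∀ U : Matrix (Fin n) (Fin n) ℂ,
      U ∈ Matrix.unitaryGroup (Fin n) ℂ →
      ((fun k => U * Prod.fst P k * star U), (fun k => U * Prod.snd P k * star U)) ∈ dom →
      u ((fun k => U * Prod.fst P k * star U), (fun k => U * Prod.snd P k * star U)) =
        U * u P * star U)
    (hopen : ∀ P ∈ dom, ∃ ε > (0 : ℝ),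
      ∀ Q : (Fin d → Matrix (Fin n) (Fin n) ℂ) × (Fin d → Matrix (Fin n) (Fin n) ℂ),
        (∀ k, (Prod.fst Q k).IsHermitian) → (∀ k, (Prod.snd Q k).IsHermitian) →
        (∀ k, opNorm (Prod.fst Q k - Prod.fst P k) < ε) →
        (∀ k, opNorm (Prod.snd Q k - Prod.snd P k) < ε) → Q ∈ dom)
    (Du : ((Fin d → Matrix (Fin n) (Fin n) ℂ) ×
        (Fin d → Matrix (Fin n) (Fin n) ℂ)) →
      ((Fin d → Matrix (Fin n) (Fin n) ℂ) × (Fin d → Matrix (Fin n) (Fin n) ℂ)) →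
      Matrix (Fin n) (Fin n) ℂ)
    (hDuadd : ∀ P ∈ dom, ∀ Z1 Z2 W1 W2 : Fin d → Matrix (Fin n) (Fin n) ℂ,
      (∀ k, (Z1 k).IsHermitian) → (∀ k, (Z2 k).IsHermitian) →
      (∀ k, (W1 k).IsHermitian) → (∀ k, (W2 k).IsHermitian) →
      Du P (Z1 + W1, Z2 + W2) = Du P (Z1, Z2) + Du P (W1, W2))
    (hDusmul : ∀ P ∈ dom, ∀ (t : ℝ) (Z1 Z2 : Fin d → Matrix (Fin n) (Fin n) ℂ),
      (∀ k, (Z1 k).IsHermitian) → (∀ k, (Z2 k).IsHermitian) →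
      Du P (t • Z1, t • Z2) = t • Du P (Z1, Z2))
    (hDuF : ∀ P ∈ dom, ∀ ε > (0 : ℝ), ∃ δ > (0 : ℝ),
      ∀ Z1 Z2 : Fin d → Matrix (Fin n) (Fin n) ℂ,
        (∀ k, (Z1 k).IsHermitian) → (∀ k, (Z2 k).IsHermitian) →
        ¬(Z1 = 0 ∧ Z2 = 0) → pNorm Z1 Z2 < δ →
        opNorm (u (P + (Z1, Z2)) - u P - Du P (Z1, Z2)) / pNorm Z1 Z2 < ε)
    (P) (hP : P ∈ dom) (S : Matrix (Fin n) (Fin n) ℂ) (hS : star S = -S) :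
    Du P ((fun k => S * P.1 k - P.1 k * S), (fun k => S * P.2 k - P.2 k * S))
      = S * u P - u P * S := by
  obtain ⟨hA, hB⟩ := hherm P hP
  let E := (Fin d → Matrix (Fin n) (Fin n) ℂ) × (Fin d → Matrix (Fin n) (Fin n) ℂ)
  let h : E → E := fun Z => ((fun k => hPart n (Z.1 k)), (fun k => hPart n (Z.2 k)))
  have hadd : ∀ Z W : E, h (Z + W) = h Z + h W := by
    intro Z W; ext1 <;> funext k <;> exact map_add _ _ _
  have hsmul : ∀ (t : ℝ) (Z : E), h (t • Z) = t • h Z := by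
    intro t Z; ext1 <;> funext k <;> exact (hPart n).map_smul t _
  let L0 : E →ₗ[ℝ] Matrix (Fin n) (Fin n) ℂ :=
    { toFun := fun Z => Du P (h Z)
      map_add' := fun Z W => by
        rw [hadd]
        exact hDuadd P hP _ _ _ _ (fun _ => hPart_herm _) (fun _ => hPart_herm _)
          (fun _ => hPart_herm _) (fun _ => hPart_herm _)
      map_smul' := fun t Z => by
        rw [hsmul]
        exact hDusmul P hP t _ _ (fun _ => hPart_herm _) (fun _ => hPart_herm _) }
  let L : E →L[ℝ] Matrix (Fin n) (Fin n) ℂ := LinearMap.toContinuousLinearMap L0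
  have hL : ∀ Z, L Z = Du P (h Z) := fun Z => rfl
  have h0 : h 0 = 0 := by
    have := hsmul 0 0
    simpa using this
  have hF : HasFDerivAt (fun Z : E => u (P + h Z)) L 0 := by
    rw [hasFDerivAt_iff_isLittleO_nhds_zero, Asymptotics.isLittleO_iff]
    intro c hc
    obtain ⟨δ, hδ, H⟩ := hDuF P hP c hc
    filter_upwards [Metric.ball_mem_nhds (0 : E) hδ] with Z hZ
    have hZ' : ‖Z‖ < δ := by simpa using hZ
    rw [zero_add, h0, add_zero, hL]
    have : Nonempty (Fin d) := ⟨⟨0, hd⟩⟩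
    have hb : ∀ k, max (opNorm ((h Z).1 k)) (opNorm ((h Z).2 k)) ≤ ‖Z‖ := by
      intro k
      apply max_le
      · exact (hPart_norm _).trans ((norm_le_pi_norm Z.1 k).trans (norm_fst_le Z))
      · exact (hPart_norm _).trans ((norm_le_pi_norm Z.2 k).trans (norm_snd_le Z))
    have hp : pNorm (h Z).1 (h Z).2 ≤ ‖Z‖ := ciSup_le hb
    have hbd : BddAbove (Set.range fun k => max (opNorm ((h Z).1 k)) (opNorm ((h Z).2 k))) :=
      ⟨‖Z‖, by rintro _ ⟨k, rfl⟩; exact hb k⟩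
    by_cases hz : (h Z).1 = 0 ∧ (h Z).2 = 0
    · have hz' : h Z = 0 := Prod.ext hz.1 hz.2
      have hz2 : Du P 0 = 0 := by
        have := L.map_zero
        rwa [hL, h0] at this
      rw [hz', hz2]; simp; positivity
    · have hk := H (h Z).1 (h Z).2 (fun _ => hPart_herm _) (fun _ => hPart_herm _) hz
        (hp.trans_lt hZ')
      have hpos : 0 < pNorm (h Z).1 (h Z).2 := by
        by_contra hn
        have hk : ∀ k, max (opNorm ((h Z).1 k)) (opNorm ((h Z).2 k)) ≤ 0 := fun k =>
          (le_ciSup hbd k).trans (not_lt.mp hn)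
        apply hz
        constructor <;> funext k
        · exact norm_le_zero_iff.mp ((le_max_left _ _).trans (hk k))
        · exact norm_le_zero_iff.mp ((le_max_right _ _).trans (hk k))
      rw [div_lt_iff₀ hpos] at hk
      exact hk.le.trans (by gcongr)
  -- the curve
  let U : ℝ → Matrix (Fin n) (Fin n) ℂ := fun t => NormedSpace.exp (t • S)
  have hU0 : U 0 = 1 := by simp [U]
  have hUd : HasDerivAt U S 0 := by
    have := hasDerivAt_exp_smul_const (𝕂 := ℝ) S (0:ℝ)
    simpa using this
  have hUs : HasDerivAt (fun t => star (U t)) (-S) 0 := by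
    have := hUd.star
    rwa [hS] at this
  have hUu : ∀ t, U t ∈ Matrix.unitaryGroup (Fin n) ℂ := by
    intro t
    letI : NormedAlgebra ℚ (Matrix (Fin n) (Fin n) ℂ) := NormedAlgebra.restrictScalars ℚ ℂ _
    apply NormedSpace.exp_mem_unitary_of_mem_skewAdjoint
    rw [skewAdjoint.mem_iff, star_smul, hS]; simp
  have hconj : ∀ M : Matrix (Fin n) (Fin n) ℂ,
      HasDerivAt (fun t => U t * M * star (U t)) (S * M - M * S) 0 := by
    intro M
    have := (hUd.mul_const M).mul hUs
    rw [hU0] at this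
    refine this.congr_deriv ?_
    simp [sub_eq_add_neg]
  let c : ℝ → E := fun t => ((fun k => U t * P.1 k * star (U t) - P.1 k),
    (fun k => U t * P.2 k * star (U t) - P.2 k))
  have hc0 : c 0 = 0 := by
    ext1 <;> funext k <;> simp [c, hU0]
  let W : E := ((fun k => S * P.1 k - P.1 k * S), (fun k => S * P.2 k - P.2 k * S))
  have hc : HasDerivAt c W 0 := by
    apply HasDerivAt.prodMk
    · rw [hasDerivAt_pi]; intro k; exact (hconj _).sub_const _
    · rw [hasDerivAt_pi]; intro k; exact (hconj _).sub_const _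
  have hch : ∀ M : Matrix (Fin n) (Fin n) ℂ, M.IsHermitian → ∀ t,
      (U t * M * star (U t)).IsHermitian := by
    intro M hM t
    have hM' : star M = M := hM
    change star _ = _
    simp [star_mul, hM', mul_assoc]
  have hhc : ∀ t, h (c t) = c t := by
    intro t
    ext1 <;> funext k
    · exact hPart_of_herm ((hch _ (hA k) t).sub (hA k))
    · exact hPart_of_herm ((hch _ (hB k) t).sub (hB k))
  have hcomp : HasDerivAt (fun t => u (P + h (c t))) (L W) 0 := by
    have hF' := hF
    rw [← hc0] at hF'
    exact hF'.comp_hasDerivAt (0:ℝ) hc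
  have hW : h W = W := by
    have hcm : ∀ M : Matrix (Fin n) (Fin n) ℂ, M.IsHermitian → (S * M - M * S).IsHermitian := by
      intro M hM
      have hM' : star M = M := hM
      change star _ = _
      simp [star_mul, hM', hS]; abel
    ext1 <;> funext k
    · exact hPart_of_herm (hcm _ (hA k))
    · exact hPart_of_herm (hcm _ (hB k))
  have hPc : ∀ t, P + c t = ((fun k => U t * P.1 k * star (U t)),
      (fun k => U t * P.2 k * star (U t))) := by
    intro t; ext1 <;> funext k <;> exact add_sub_cancel _ _
  obtain ⟨ε, hε, hop⟩ := hopen P hP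
  have hev : (fun t => U t * u P * star (U t)) =ᶠ[𝓝 0] (fun t => u (P + h (c t))) := by
    have hcont : Tendsto c (𝓝 0) (𝓝 0) := by
      have := hc.continuousAt.tendsto
      rwa [hc0] at this
    filter_upwards [hcont (Metric.ball_mem_nhds (0 : E) hε)] with t ht
    have ht' : ‖c t‖ < ε := by simpa using ht
    rw [hhc, hPc]
    refine (huu P hP (U t) (hUu t) ?_).symm
    refine hop _ (fun k => hch _ (hA k) t) (fun k => hch _ (hB k) t) (fun k => ?_) (fun k => ?_)
    · exact ((norm_le_pi_norm (c t).1 k).trans (norm_fst_le _)).trans_lt ht'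
    · exact ((norm_le_pi_norm (c t).2 k).trans (norm_snd_le _)).trans_lt ht'
  have := (hcomp.congr_of_eventuallyEq hev).unique (hconj (u P))
  rw [hL, hW] at this
  exact this

end helpers

/-- For `f = u + iv` built from Fréchet differentiable real nc functions
satisfying the nc Cauchy–Riemann equations, `Df(X)([T,X]) = [T, f(X)]`. -/
theorem f_from_u_v_commutator_formula (d : ℕ) (hd : 0 < d)
    (Du_dom : ∀ n : ℕ, Set ((Fin d → Matrix (Fin n) (Fin n) ℂ) ×
      (Fin d → Matrix (Fin n) (Fin n) ℂ)))
    (hDu_domherm : ∀ n, ∀ P ∈ Du_dom n,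
      (∀ k, (Prod.fst P k).IsHermitian) ∧ (∀ k, (Prod.snd P k).IsHermitian))
    (hDu_domsum : ∀ n m, ∀ P ∈ Du_dom n, ∀ Q ∈ Du_dom m,
      (dSumT (Prod.fst P) (Prod.fst Q), dSumT (Prod.snd P) (Prod.snd Q)) ∈ Du_dom (n + m))
    (u : ∀ n : ℕ, ((Fin d → Matrix (Fin n) (Fin n) ℂ) ×
      (Fin d → Matrix (Fin n) (Fin n) ℂ)) → Matrix (Fin n) (Fin n) ℂ)
    (huherm : ∀ n, ∀ P ∈ Du_dom n, (u n P).IsHermitian)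
    (husum : ∀ n m, ∀ P ∈ Du_dom n, ∀ Q ∈ Du_dom m,
      u (n + m) (dSumT (Prod.fst P) (Prod.fst Q), dSumT (Prod.snd P) (Prod.snd Q)) =
        dSum (u n P) (u m Q))
    (huu : ∀ n, ∀ P ∈ Du_dom n, ∀ U : Matrix (Fin n) (Fin n) ℂ,
      U ∈ Matrix.unitaryGroup (Fin n) ℂ →
      ((fun k => U * Prod.fst P k * star U), (fun k => U * Prod.snd P k * star U)) ∈ Du_dom n →
      u n ((fun k => U * Prod.fst P k * star U), (fun k => U * Prod.snd P k * star U)) =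
        U * u n P * star U)
    (hDu_domopen : ∀ n, ∀ P ∈ Du_dom n, ∃ ε > (0 : ℝ),
      ∀ Q : (Fin d → Matrix (Fin n) (Fin n) ℂ) × (Fin d → Matrix (Fin n) (Fin n) ℂ),
        (∀ k, (Prod.fst Q k).IsHermitian) → (∀ k, (Prod.snd Q k).IsHermitian) →
        (∀ k, opNorm (Prod.fst Q k - Prod.fst P k) < ε) →
        (∀ k, opNorm (Prod.snd Q k - Prod.snd P k) < ε) → Q ∈ Du_dom n)
    (Dv_dom : ∀ n : ℕ, Set ((Fin d → Matrix (Fin n) (Fin n) ℂ) ×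
      (Fin d → Matrix (Fin n) (Fin n) ℂ)))
    (hDv_domherm : ∀ n, ∀ P ∈ Dv_dom n,
      (∀ k, (Prod.fst P k).IsHermitian) ∧ (∀ k, (Prod.snd P k).IsHermitian))
    (hDv_domsum : ∀ n m, ∀ P ∈ Dv_dom n, ∀ Q ∈ Dv_dom m,
      (dSumT (Prod.fst P) (Prod.fst Q), dSumT (Prod.snd P) (Prod.snd Q)) ∈ Dv_dom (n + m))
    (v : ∀ n : ℕ, ((Fin d → Matrix (Fin n) (Fin n) ℂ) ×
      (Fin d → Matrix (Fin n) (Fin n) ℂ)) → Matrix (Fin n) (Fin n) ℂ)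
    (hvherm : ∀ n, ∀ P ∈ Dv_dom n, (v n P).IsHermitian)
    (hvsum : ∀ n m, ∀ P ∈ Dv_dom n, ∀ Q ∈ Dv_dom m,
      v (n + m) (dSumT (Prod.fst P) (Prod.fst Q), dSumT (Prod.snd P) (Prod.snd Q)) =
        dSum (v n P) (v m Q))
    (hvu : ∀ n, ∀ P ∈ Dv_dom n, ∀ U : Matrix (Fin n) (Fin n) ℂ,
      U ∈ Matrix.unitaryGroup (Fin n) ℂ →
      ((fun k => U * Prod.fst P k * star U), (fun k => U * Prod.snd P k * star U)) ∈ Dv_dom n →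
      v n ((fun k => U * Prod.fst P k * star U), (fun k => U * Prod.snd P k * star U)) =
        U * v n P * star U)
    (hDv_domopen : ∀ n, ∀ P ∈ Dv_dom n, ∃ ε > (0 : ℝ),
      ∀ Q : (Fin d → Matrix (Fin n) (Fin n) ℂ) × (Fin d → Matrix (Fin n) (Fin n) ℂ),
        (∀ k, (Prod.fst Q k).IsHermitian) → (∀ k, (Prod.snd Q k).IsHermitian) →
        (∀ k, opNorm (Prod.fst Q k - Prod.fst P k) < ε) →
        (∀ k, opNorm (Prod.snd Q k - Prod.snd P k) < ε) → Q ∈ Dv_dom n)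
    (Du : ∀ n : ℕ, ((Fin d → Matrix (Fin n) (Fin n) ℂ) ×
        (Fin d → Matrix (Fin n) (Fin n) ℂ)) →
      ((Fin d → Matrix (Fin n) (Fin n) ℂ) × (Fin d → Matrix (Fin n) (Fin n) ℂ)) →
      Matrix (Fin n) (Fin n) ℂ)
    (hDuadd : ∀ n, ∀ P ∈ Du_dom n, ∀ Z1 Z2 W1 W2 : Fin d → Matrix (Fin n) (Fin n) ℂ,
      (∀ k, (Z1 k).IsHermitian) → (∀ k, (Z2 k).IsHermitian) →
      (∀ k, (W1 k).IsHermitian) → (∀ k, (W2 k).IsHermitian) →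
      Du n P (Z1 + W1, Z2 + W2) = Du n P (Z1, Z2) + Du n P (W1, W2))
    (hDusmul : ∀ n, ∀ P ∈ Du_dom n, ∀ (t : ℝ) (Z1 Z2 : Fin d → Matrix (Fin n) (Fin n) ℂ),
      (∀ k, (Z1 k).IsHermitian) → (∀ k, (Z2 k).IsHermitian) →
      Du n P (t • Z1, t • Z2) = t • Du n P (Z1, Z2))
    (hDuF : ∀ n, ∀ P ∈ Du_dom n, ∀ ε > (0 : ℝ), ∃ δ > (0 : ℝ),
      ∀ Z1 Z2 : Fin d → Matrix (Fin n) (Fin n) ℂ,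
        (∀ k, (Z1 k).IsHermitian) → (∀ k, (Z2 k).IsHermitian) →
        ¬(Z1 = 0 ∧ Z2 = 0) → pNorm Z1 Z2 < δ →
        opNorm (u n (P + (Z1, Z2)) - u n P - Du n P (Z1, Z2)) / pNorm Z1 Z2 < ε)
    (Dv : ∀ n : ℕ, ((Fin d → Matrix (Fin n) (Fin n) ℂ) ×
        (Fin d → Matrix (Fin n) (Fin n) ℂ)) →
      ((Fin d → Matrix (Fin n) (Fin n) ℂ) × (Fin d → Matrix (Fin n) (Fin n) ℂ)) →
      Matrix (Fin n) (Fin n) ℂ)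
    (hDvadd : ∀ n, ∀ P ∈ Dv_dom n, ∀ Z1 Z2 W1 W2 : Fin d → Matrix (Fin n) (Fin n) ℂ,
      (∀ k, (Z1 k).IsHermitian) → (∀ k, (Z2 k).IsHermitian) →
      (∀ k, (W1 k).IsHermitian) → (∀ k, (W2 k).IsHermitian) →
      Dv n P (Z1 + W1, Z2 + W2) = Dv n P (Z1, Z2) + Dv n P (W1, W2))
    (hDvsmul : ∀ n, ∀ P ∈ Dv_dom n, ∀ (t : ℝ) (Z1 Z2 : Fin d → Matrix (Fin n) (Fin n) ℂ),
      (∀ k, (Z1 k).IsHermitian) → (∀ k, (Z2 k).IsHermitian) →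
      Dv n P (t • Z1, t • Z2) = t • Dv n P (Z1, Z2))
    (hDvF : ∀ n, ∀ P ∈ Dv_dom n, ∀ ε > (0 : ℝ), ∃ δ > (0 : ℝ),
      ∀ Z1 Z2 : Fin d → Matrix (Fin n) (Fin n) ℂ,
        (∀ k, (Z1 k).IsHermitian) → (∀ k, (Z2 k).IsHermitian) →
        ¬(Z1 = 0 ∧ Z2 = 0) → pNorm Z1 Z2 < δ →
        opNorm (v n (P + (Z1, Z2)) - v n P - Dv n P (Z1, Z2)) / pNorm Z1 Z2 < ε)
    (hCR : ∀ n, ∀ P, P ∈ Du_dom n → P ∈ Dv_dom n →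
      ∀ Z1 Z2 : Fin d → Matrix (Fin n) (Fin n) ℂ,
        (∀ k, (Z1 k).IsHermitian) → (∀ k, (Z2 k).IsHermitian) →
        Du n P (Z1, Z2) = Dv n P (-Z2, Z1)) :
    ∀ n, ∀ P, P ∈ Du_dom n → P ∈ Dv_dom n →
      ∀ T : Matrix (Fin n) (Fin n) ℂ,
      ∀ Z1 Z2 : Fin d → Matrix (Fin n) (Fin n) ℂ,
        (∀ k, (Z1 k).IsHermitian) → (∀ k, (Z2 k).IsHermitian) →
        -- `Z₁ + iZ₂ = [T, X]` entrywise, where `X = A + iB`: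
        (∀ k, Z1 k + Complex.I • Z2 k =
          T * (Prod.fst P k + Complex.I • Prod.snd P k) -
            (Prod.fst P k + Complex.I • Prod.snd P k) * T) →
        -- `Df(X)([T,X]) = [T, f(X)]`:
        Du n P (Z1, Z2) + Complex.I • Dv n P (Z1, Z2) =
          T * (u n P + Complex.I • v n P) - (u n P + Complex.I • v n P) * T := by
  intro n P hPu hPv T Z1 Z2 hZ1 hZ2 hZ
  obtain ⟨hA, hB⟩ := hDu_domherm n P hPu
  have key_u := skew_case d n hd (Du_dom n) (hDu_domherm n) (u n) (huu n) (hDu_domopen n) (Du n)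
    (hDuadd n) (hDusmul n) (hDuF n) P hPu
  have key_v := skew_case d n hd (Dv_dom n) (hDv_domherm n) (v n) (hvu n) (hDv_domopen n) (Dv n)
    (hDvadd n) (hDvsmul n) (hDvF n) P hPv
  have hcm : ∀ S : Matrix (Fin n) (Fin n) ℂ, star S = -S →
      ∀ M : Matrix (Fin n) (Fin n) ℂ, M.IsHermitian → (S * M - M * S).IsHermitian := by
    intro S hS M hM
    have hM' : star M = M := hM
    change star _ = _
    simp [star_mul, hM', hS]; abel
  obtain ⟨S, R, hS, hR, hT⟩ : ∃ S R : Matrix (Fin n) (Fin n) ℂ, star S = -S ∧ star R = -R ∧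
      T = S + Complex.I • R := by
    refine ⟨(1/2 : ℂ) • (T - star T), (-Complex.I/2) • (T + star T), ?_, ?_, ?_⟩
    · rw [star_smul, star_sub, star_star, ← smul_neg, neg_sub]; simp
    · rw [star_smul, star_add, star_star, ← neg_smul, add_comm]
      congr 1
      simp [neg_div]
    · rw [smul_smul]
      have : Complex.I * (-Complex.I/2) = 1/2 := by
        rw [mul_div_assoc', mul_neg, Complex.I_mul_I, neg_neg]
      rw [this, ← smul_add, sub_add_add_cancel, ← two_smul ℂ, smul_smul]; norm_num
  let c : Matrix (Fin n) (Fin n) ℂ → (Fin d → Matrix (Fin n) (Fin n) ℂ) →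
    Fin d → Matrix (Fin n) (Fin n) ℂ := fun S A k => S * A k - A k * S
  have hre : ∀ A B C D : Matrix (Fin n) (Fin n) ℂ, A.IsHermitian → B.IsHermitian →
      C.IsHermitian → D.IsHermitian → A + Complex.I • B = C + Complex.I • D → A = C ∧ B = D := by
    intro A B C D hA hB hC hD hh
    have hA' : star A = A := hA
    have hB' : star B = B := hB
    have hC' : star C = C := hC
    have hD' : star D = D := hD
    have h2 := congrArg star hh
    simp only [star_add, star_smul, hA', hB', hC', hD'] at h2
    have h3 : A = C := by
      have : (2:ℂ) • A = (2:ℂ) • C := by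
        have := congrArg₂ (· + ·) hh h2
        simp only [Complex.star_def, Complex.conj_I, neg_smul] at this
        rw [two_smul, two_smul]
        calc A + A = A + Complex.I • B + (A + -(Complex.I • B)) := by abel
          _ = _ := this
          _ = _ := by abel
      exact smul_right_injective _ (two_ne_zero) this
    refine ⟨h3, ?_⟩
    rw [h3] at hh
    exact smul_right_injective _ Complex.I_ne_zero (add_left_cancel hh)
  have hZ12 : ∀ k, Z1 k = c S P.1 k + (-(c R P.2)) k ∧ Z2 k = c S P.2 k + c R P.1 k := by
    intro k
    apply hre _ _ _ _ (hZ1 k) (hZ2 k)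
    · exact (hcm S hS _ (hA k)).add (hcm R hR _ (hB k)).neg
    · exact (hcm S hS _ (hB k)).add (hcm R hR _ (hA k))
    · rw [hZ k, hT]
      simp only [c, Pi.neg_apply, add_mul, mul_add, smul_mul_assoc, mul_smul_comm, smul_add,
        smul_sub, smul_smul, Complex.I_mul_I, neg_smul, one_smul]
      abel
  have e1 : Z1 = c S P.1 + -(c R P.2) := funext fun k => (hZ12 k).1
  have e2 : Z2 = c S P.2 + c R P.1 := funext fun k => (hZ12 k).2
  have hnegB : ∀ k, ((-(c R P.2)) k).IsHermitian := fun k => (hcm R hR _ (hB k)).neg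
  have du : Du n P (Z1, Z2) = Du n P (c S P.1, c S P.2) + Du n P (-(c R P.2), c R P.1) := by
    rw [e1, e2]
    exact hDuadd n P hPu _ _ _ _ (fun k => hcm S hS _ (hA k)) (fun k => hcm S hS _ (hB k))
      hnegB (fun k => hcm R hR _ (hA k))
  have dv : Dv n P (Z1, Z2) = Dv n P (c S P.1, c S P.2) + Dv n P (-(c R P.2), c R P.1) := by
    rw [e1, e2]
    exact hDvadd n P hPv _ _ _ _ (fun k => hcm S hS _ (hA k)) (fun k => hcm S hS _ (hB k))
      hnegB (fun k => hcm R hR _ (hA k))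
  have cr1 : Dv n P (-(c R P.2), c R P.1) = R * u n P - u n P * R := by
    rw [← hCR n P hPu hPv _ _ (fun k => hcm R hR _ (hA k)) (fun k => hcm R hR _ (hB k))]
    exact key_u R hR
  have cr2 : Du n P (-(c R P.2), c R P.1) = -(R * v n P - v n P * R) := by
    rw [hCR n P hPu hPv _ _ hnegB (fun k => hcm R hR _ (hA k)), ← key_v R hR]
    have := hDvsmul n P hPv (-1) _ _ (fun k => hcm R hR _ (hA k)) (fun k => hcm R hR _ (hB k))
    simpa only [neg_smul, one_smul] using this
  have k1 : Du n P (c S P.1, c S P.2) = _ := key_u S hS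
  have k2 : Dv n P (c S P.1, c S P.2) = _ := key_v S hS
  rw [du, dv, cr1, cr2, k1, k2, hT]
  simp only [add_mul, mul_add, smul_mul_assoc, mul_smul_comm, smul_add,
    smul_sub, smul_smul, Complex.I_mul_I, neg_smul, one_smul]
  abel
end
end
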